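/- arXiv:2012.14824 — 7 statements merged into one kernel-verified Lean document; each statement's English description precedes it below -/
import Mathlib

section
/- Let K be a number field that is Galois over ℚ of degree 3. Then the 2-rank of the ideal class group of K is even; equivalently, the number of elements x of the class group ClassGroup(𝒪_K) with x² = 1 equals 4^d for some non-negative integer d. -/
open NumberField

open scoped Pointwise nonZeroDivisors

namespace ClassGroup

variable {G R : Type*} [Group G] [CommRing R] [IsDedekindDomain R] [MulSemiringAction G R]

theorem smul_mem_nonZeroDivisors (g : G) {I : Ideal R} (hI : I ∈ (Ideal R)⁰) :
    g • I ∈ (Ideal R)⁰ := by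
  rw [mem_nonZeroDivisors_iff_ne_zero] at hI ⊢
  rwa [smul_ne_zero_iff_ne]

/-- The class of the image of an integral representative under a ring automorphism. -/
noncomputable def galoisSMul (g : G) (c : ClassGroup R) : ClassGroup R :=
  mk0 ⟨g • (mk0_surjective c).choose.1, smul_mem_nonZeroDivisors g (mk0_surjective c).choose.2⟩

theorem galoisSMul_mk0 (g : G) (I : (Ideal R)⁰) :
    galoisSMul g (mk0 I) = mk0 ⟨g • I.1, smul_mem_nonZeroDivisors g I.2⟩ := by
  obtain ⟨x, y, hx, hy, h⟩ := mk0_eq_mk0_iff.1 (mk0_surjective (mk0 I)).choose_spec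
  refine mk0_eq_mk0_iff.2 ⟨g • x, g • y, (smul_ne_zero_iff_ne g).2 hx,
    (smul_ne_zero_iff_ne g).2 hy, ?_⟩
  have := congrArg (g • ·) h
  simpa only [smul_mul', Ideal.smul_closure, Set.smul_set_singleton] using this

/-- The action of a group of ring automorphisms on the ideal class group. -/
noncomputable abbrev galoisAction : MulDistribMulAction G (ClassGroup R) where
  smul := galoisSMul
  one_smul c := by
    obtain ⟨I, rfl⟩ := mk0_surjective c
    exact (galoisSMul_mk0 1 I).trans (by simp)
  mul_smul g h c := by
    obtain ⟨I, rfl⟩ := mk0_surjective c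
    change galoisSMul _ _ = galoisSMul _ (galoisSMul _ _)
    simp [galoisSMul_mk0, mul_smul]
  smul_mul g c d := by
    obtain ⟨I, rfl⟩ := mk0_surjective c
    obtain ⟨J, rfl⟩ := mk0_surjective d
    change galoisSMul _ _ = galoisSMul _ _ * galoisSMul _ _
    simp only [← map_mul, galoisSMul_mk0]
    congr 2
    exact smul_mul' g I.1 J.1
  smul_one g := by
    change galoisSMul _ _ = _
    rw [← map_one mk0, galoisSMul_mk0]
    congr 2
    exact smul_one g

end ClassGroup

namespace NumberField

variable {K : Type*} [Field K] [NumberField K] [IsGalois ℚ K]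

theorem prod_galois_smul_eq_algebraMap_norm (x : 𝓞 K) :
    ∏ g : Gal(K/ℚ), g • x = algebraMap ℤ (𝓞 K) (Algebra.norm ℤ x) := by
  apply RingOfIntegers.ext
  have h := Algebra.norm_eq_prod_automorphisms ℚ (x : K)
  rw [← Algebra.coe_norm_int] at h
  refine (map_prod (algebraMap (𝓞 K) K) _ _).trans ?_
  simpa using! h.symm

/-- The product of the Galois conjugates of an ideal is generated by its absolute norm. -/
theorem prod_galois_smul_ideal (I : Ideal (𝓞 K)) :
    ∏ g : Gal(K/ℚ), g • I = Ideal.span {(Ideal.absNorm I : 𝓞 K)} := by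
  rcases eq_or_ne I ⊥ with rfl | hI
  · simp
  have hle : (Ideal.relNorm ℤ I).map (algebraMap ℤ (𝓞 K)) ≤ ∏ g : Gal(K/ℚ), g • I := by
    rw [← Ideal.spanNorm_eq, Ideal.spanNorm, Ideal.map_le_iff_le_comap, Ideal.map, Ideal.span_le]
    rintro _ ⟨x, hx, rfl⟩
    rw [SetLike.mem_coe, Ideal.mem_comap, Algebra.intNorm_eq_norm,
      ← prod_galois_smul_eq_algebraMap_norm]
    exact Ideal.prod_mem_prod fun g _ ↦ Ideal.smul_mem_pointwise_smul g x I hx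
  have hspan : (Ideal.relNorm ℤ I).map (algebraMap ℤ (𝓞 K)) =
      Ideal.span {(Ideal.absNorm I : 𝓞 K)} := by
    rw [Ideal.relNorm_int, Ideal.map_span]
    simp
  have habs (g : Gal(K/ℚ)) : Ideal.absNorm (g • I) = Ideal.absNorm I := by
    rw [← Ideal.absNorm_relNorm ℤ, Ideal.relNorm_smul, Ideal.absNorm_relNorm]
  rw [← hspan]
  obtain ⟨J, hJ⟩ := Ideal.dvd_iff_le.2 hle
  have hnorm := congrArg Ideal.absNorm hJ
  rw [Ideal.absNorm_algebraMap, Ideal.absNorm_relNorm, map_mul, map_prod,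
    Finset.prod_congr rfl fun g _ ↦ habs g, Finset.prod_const, Finset.card_univ,
    ← Nat.card_eq_fintype_card, IsGalois.card_aut_eq_finrank,
    ← RingOfIntegers.rank K] at hnorm
  have h0 : Ideal.absNorm I ≠ 0 := by simpa [Ideal.absNorm_eq_zero_iff] using hI
  have : J = ⊤ := by
    rw [← Ideal.absNorm_eq_one_iff]
    exact (mul_eq_left₀ (pow_ne_zero _ h0)).1 hnorm.symm
  rw [hJ, this, Ideal.mul_top]

end NumberField

theorem two_rank_classGroup_even_of_cyclic_cubic
    (K : Type*) [Field K] [NumberField K] [IsGalois ℚ K]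
    (hdeg : Module.finrank ℚ K = 3) :
    ∃ d : ℕ, Nat.card {x : ClassGroup (𝓞 K) // x ^ 2 = 1} = 4 ^ d := by
  let _ : MulDistribMulAction Gal(K/ℚ) (ClassGroup (𝓞 K)) := ClassGroup.galoisAction
  let _ : MulAction Gal(K/ℚ) {x : ClassGroup (𝓞 K) // x ^ 2 = 1} :=
    { smul g x := ⟨g • x.1, by rw [← smul_pow', x.2, smul_one]⟩
      one_smul x := Subtype.ext (one_smul _ x.1)
      mul_smul g h x := Subtype.ext (mul_smul g h x.1) }
  have hcard : Nat.card Gal(K/ℚ) = 3 := by rw [IsGalois.card_aut_eq_finrank, hdeg]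
  have hnorm (c : ClassGroup (𝓞 K)) : ∏ g : Gal(K/ℚ), g • c = 1 := by
    obtain ⟨I, rfl⟩ := ClassGroup.mk0_surjective c
    have h (g : Gal(K/ℚ)) : g • ClassGroup.mk0 I = ClassGroup.mk0
        ⟨g • I.1, ClassGroup.smul_mem_nonZeroDivisors g I.2⟩ := ClassGroup.galoisSMul_mk0 g I
    simp only [h, ← map_prod]
    rw [← Subtype.coe_eta (∏ g : Gal(K/ℚ), _) (SetLike.coe_mem _), ClassGroup.mk0_eq_one_iff]
    simp only [Submonoid.coe_finsetProd, NumberField.prod_galois_smul_ideal]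
    exact ⟨_, rfl⟩
  have hfix : Nat.card (MulAction.fixedPoints Gal(K/ℚ)
      {x : ClassGroup (𝓞 K) // x ^ 2 = 1}) = 1 := by
    rw [Nat.card_eq_one_iff_exists]
    refine ⟨⟨⟨1, one_pow 2⟩, fun g ↦ Subtype.ext (smul_one g)⟩, fun ⟨⟨c, hc⟩, hcf⟩ ↦ ?_⟩
    have h := hnorm c
    rw [Finset.prod_congr rfl fun g _ ↦ show g • c = c from congrArg Subtype.val (hcf g), Finset.prod_const,
      Finset.card_univ, ← Nat.card_eq_fintype_card, hcard, pow_succ, hc, one_mul] at h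
    exact Subtype.ext (Subtype.ext h)
  have : Fact (Nat.Prime 3) := ⟨Nat.prime_three⟩
  have hmod := (IsPGroup.of_card (p := 3) (n := 1)
    (by rw [hcard, pow_one])).card_modEq_card_fixedPoints {x : ClassGroup (𝓞 K) // x ^ 2 = 1}
  rw [hfix] at hmod
  obtain ⟨r, hr⟩ : ∃ r, Nat.card {x : ClassGroup (𝓞 K) // x ^ 2 = 1} = 2 ^ r := by
    have h2 : IsPGroup 2 (powMonoidHom 2 : ClassGroup (𝓞 K) →* _).ker :=
      fun x ↦ ⟨1, Subtype.ext x.2⟩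
    have : Fact (Nat.Prime 2) := ⟨Nat.prime_two⟩
    obtain ⟨r, hr⟩ := IsPGroup.iff_card.1 h2
    exact ⟨r, hr⟩
  rw [hr] at hmod ⊢
  obtain ⟨d, rfl | rfl⟩ := r.even_or_odd'
  · exact ⟨d, by rw [pow_mul]; norm_num⟩
  · have h4 : 4 ^ d ≡ 1 [MOD 3] := by simpa using (show 4 ≡ 1 [MOD 3] from rfl).pow d
    rw [pow_succ, pow_mul] at hmod
    norm_num [Nat.ModEq] at hmod h4
    omega
end

section
/- Let K be a number field that is Galois over ℚ of degree 3. Then the order of a Sylow 2-subgroup of the ideal class group ClassGroup(𝒪_K) is a perfect square. -/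
open NumberField

open scoped nonZeroDivisors Pointwise

namespace Ideal

/-- The product of the conjugates of a prime `P` lying over `p` is a power of the extension
of `p`. -/
theorem prod_smul_eq_map_pow {R S : Type*} [CommRing R] [IsDedekindDomain R] [CommRing S]
    [IsDedekindDomain S] [Algebra R S] [Module.Finite R S] [Module.IsTorsionFree R S]
    (G : Type*) [Group G] [Fintype G] [MulSemiringAction G S] [IsGaloisGroup G R S]
    (p : Ideal R) [p.IsMaximal] (hp : p ≠ ⊥) (P : Ideal S) [P.IsPrime] [P.LiesOver p] :
    ∏ g : G, g • P = p.map (algebraMap R S) ^ p.inertiaDegIn S := by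
  classical
  have hcard (Q : Ideal S) (hQ : Q ∈ p.primesOver S) :
      Finset.card {g : G | g • P = Q} = p.ramificationIdxIn S * p.inertiaDegIn S := by
    have := hQ.1
    have := hQ.2
    obtain ⟨h, rfl⟩ := exists_smul_eq_of_isGaloisGroup p P Q G
    have hstab : Finset.card {g : G | g • P = h • P} =
        Nat.card (MulAction.stabilizer G P) := by
      rw [Nat.card_eq_fintype_card, Fintype.card_subtype]
      refine Finset.card_bij' (fun g _ ↦ h⁻¹ * g) (fun g _ ↦ h * g) ?_ ?_ ?_ ?_ <;>
        simp +contextual [mul_smul, MulAction.mem_stabilizer_iff]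
    have hindex := (MulAction.stabilizer G P).index_mul_card
    rw [MulAction.index_stabilizer, Algebra.IsInvariant.orbit_eq_primesOver R S G p P,
      ← ncard_primesOver_mul_ramificationIdxIn_mul_inertiaDegIn p S G] at hindex
    rw [hstab]
    exact mul_left_cancel₀ (IsDedekindDomain.primesOver_ncard_ne_zero p S) hindex
  rw [map_algebraMap_eq_finsetProd_pow hp, ← Finset.prod_pow,
    ← Finset.prod_fiberwise_of_maps_to (s := Finset.univ) (t := (p.primesOver S).toFinset)
      (g := fun g : G ↦ g • P)]
  · refine Finset.prod_congr rfl fun Q hQ ↦ ?_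
    rw [Set.mem_toFinset] at hQ
    have := hQ.1
    have := hQ.2
    rw [Finset.prod_congr rfl (g := fun _ ↦ Q) (by simp), Finset.prod_const, hcard Q hQ, pow_mul,
      ramificationIdxIn_eq_ramificationIdx p Q G]
  · intro g _
    rw [Set.mem_toFinset, ← Algebra.IsInvariant.orbit_eq_primesOver R S G p P]
    exact MulAction.mem_orbit P g

/-- Over a principal ideal domain, the product of the conjugates of an ideal is principal. -/
theorem isPrincipal_prod_smul (R : Type*) {S : Type*} [CommRing R] [IsDomain R]
    [IsPrincipalIdealRing R] [CommRing S] [IsDedekindDomain S] [Algebra R S] [Module.Finite R S]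
    [Module.IsTorsionFree R S] (G : Type*) [Group G] [Fintype G] [MulSemiringAction G S]
    [IsGaloisGroup G R S] (I : Ideal S) : (∏ g : G, g • I).IsPrincipal := by
  rw [← mem_isPrincipalSubmonoid_iff]
  induction I using UniqueFactorizationMonoid.induction_on_prime with
  | h₁ =>
    refine Submonoid.prod_mem _ fun g _ ↦ ?_
    rw [zero_eq_bot, smul_bot]
    exact bot_isPrincipal
  | h₂ I hI =>
    refine Submonoid.prod_mem _ fun g _ ↦ ?_
    rw [isUnit_iff.mp hI, pointwise_smul_def, map_top]
    exact top_isPrincipal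
  | h₃ I P _ hP hI =>
    have := isPrime_of_prime hP
    have := this.isMaximal hP.ne_zero
    simp_rw [smul_mul', Finset.prod_mul_distrib]
    refine mul_mem ?_ hI
    rw [prod_smul_eq_map_pow G (P.under R) (under_ne_bot R hP.ne_zero) P]
    refine pow_mem ?_ _
    rw [← span_singleton_generator (P.under R), map_span, Set.image_singleton]
    exact span_singleton_mem_isPrincipalSubmonoid _

theorem smul_mem_nonZeroDivisors {S G : Type*} [CommRing S] [IsDomain S] [Group G]
    [MulSemiringAction G S] (g : G) {I : Ideal S} (hI : I ∈ (Ideal S)⁰) : g • I ∈ (Ideal S)⁰ := by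
  rw [mem_nonZeroDivisors_iff_ne_zero] at hI ⊢
  rwa [smul_ne_zero_iff_ne]

end Ideal

theorem FractionalIdeal.ringEquivOfRingEquiv_coeIdeal {R S : Type*} [CommRing R] [IsDomain R]
    [CommRing S] [IsDomain S] (K L : Type*) [Field K] [Algebra R K] [IsFractionRing R K] [Field L]
    [Algebra S L] [IsFractionRing S L] (f : R ≃+* S) (I : Ideal R) :
    ringEquivOfRingEquiv K L f (I : FractionalIdeal R⁰ K) = (I.map f : Ideal S) := by
  apply FractionalIdeal.coeToSubmodule_injective
  ext x
  change x ∈ (ringEquivOfRingEquiv K L f (I : FractionalIdeal R⁰ K)).val ↔ _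
  rw [ringEquivOfRingEquiv_apply_val]
  simp [IsLocalization.coeSubmodule, Ideal.mem_map_of_equiv,
    IsFractionRing.semilinearEquivOfRingEquiv]

namespace ClassGroup

theorem mulEquiv_mk0 {R S : Type*} [CommRing R] [IsDedekindDomain R] [CommRing S]
    [IsDedekindDomain S] (f : R ≃+* S) (I : (Ideal R)⁰) (J : (Ideal S)⁰)
    (hJ : (J : Ideal S) = (I : Ideal R).map f) : mulEquiv f (mk0 I) = mk0 J := by
  apply (ClassGroup.equiv (FractionRing S)).injective
  rw [mulEquiv, MulEquiv.trans_apply, MulEquiv.trans_apply, MulEquiv.apply_symm_apply, equiv_mk0,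
    equiv_mk0]
  refine congrArg (QuotientGroup.mk' _) (Units.ext ?_)
  simp [hJ, FractionalIdeal.ringEquivOfRingEquiv_coeIdeal]

variable {S : Type*} [CommRing S] [IsDedekindDomain S] (G : Type*) [Group G]
  [MulSemiringAction G S]

theorem mulEquiv_toRingEquiv_mk0 (g : G) (I : Ideal S) (hI : I ∈ (Ideal S)⁰)
    (hgI : g • I ∈ (Ideal S)⁰) :
    mulEquiv (MulSemiringAction.toRingEquiv G S g) (mk0 ⟨I, hI⟩) = mk0 ⟨g • I, hgI⟩ :=
  mulEquiv_mk0 _ _ _ rfl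

/-- The action on the class group induced by an action on the ring. -/
@[reducible]
noncomputable def mulDistribMulAction : MulDistribMulAction G (ClassGroup S) where
  smul g c := mulEquiv (MulSemiringAction.toRingEquiv G S g) c
  one_smul c := by
    obtain ⟨⟨I, hI⟩, rfl⟩ := mk0_surjective c
    exact mulEquiv_mk0 _ _ _ (one_smul G I).symm
  mul_smul g h c := by
    obtain ⟨⟨I, hI⟩, rfl⟩ := mk0_surjective c
    change mulEquiv _ _ = mulEquiv _ (mulEquiv _ _)
    have hh := Ideal.smul_mem_nonZeroDivisors h hI
    have hgh := Ideal.smul_mem_nonZeroDivisors g hh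
    rw [mulEquiv_toRingEquiv_mk0 G h I hI hh, mulEquiv_toRingEquiv_mk0 G g _ hh hgh]
    exact mulEquiv_mk0 _ _ _ (mul_smul g h I).symm
  smul_mul g := map_mul _
  smul_one g := map_one _

attribute [local instance] mulDistribMulAction

theorem smul_mk0 (g : G) (I : Ideal S) (hI : I ∈ (Ideal S)⁰) (hgI : g • I ∈ (Ideal S)⁰) :
    g • mk0 ⟨I, hI⟩ = mk0 ⟨g • I, hgI⟩ :=
  mulEquiv_toRingEquiv_mk0 G g I hI hgI

/-- Over a principal ideal domain, the norm element of the Galois group kills the class group. -/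
theorem prod_smul_eq_one (R : Type*) [CommRing R] [IsDomain R] [IsPrincipalIdealRing R]
    [Algebra R S] [Module.Finite R S] [Module.IsTorsionFree R S] [Fintype G]
    [IsGaloisGroup G R S] (c : ClassGroup S) : ∏ g : G, g • c = 1 := by
  obtain ⟨⟨I, hI⟩, rfl⟩ := mk0_surjective c
  rw [Finset.prod_congr rfl fun g _ ↦ smul_mk0 G g I hI (Ideal.smul_mem_nonZeroDivisors g hI),
    ← map_prod]
  have hmk0 (J : (Ideal S)⁰) (hJ : (J : Ideal S).IsPrincipal) : mk0 J = 1 :=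
    (mk0_eq_one_iff J.2).mpr hJ
  refine hmk0 _ ?_
  rw [Submonoid.coe_finsetProd]
  exact Ideal.isPrincipal_prod_smul R G I

end ClassGroup

/-- If a group of order `3` acts with only one fixed point on a finite set whose order is a power
of `2`, then this order is a square. -/
theorem MulAction.isSquare_card_of_card_fixedPoints_eq_one {G α : Type*} [Group G] [MulAction G α]
    [Finite α] (hG : Nat.card G = 3) {n : ℕ} (hα : Nat.card α = 2 ^ n)
    (hfix : Nat.card (MulAction.fixedPoints G α) = 1) : IsSquare (Nat.card α) := by
  have hp : IsPGroup 3 G := IsPGroup.of_card (n := 1) (by simpa using hG)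
  have : Fact (Nat.Prime 3) := ⟨Nat.prime_three⟩
  have h := hp.card_modEq_card_fixedPoints α
  rw [hfix, hα] at h
  rw [hα]
  rcases Nat.even_or_odd' n with ⟨k, rfl | rfl⟩
  · exact ⟨2 ^ k, by ring⟩
  · have h4 : 4 ^ k ≡ 1 [MOD 3] := by simpa using Nat.ModEq.pow k (show 4 ≡ 1 [MOD 3] by rfl)
    rw [pow_succ, pow_mul] at h
    exact absurd ((h4.mul_right 2).symm.trans h) (by decide)

/-- For a number field `K` Galois of degree 3 over `ℚ`, the order of a Sylow
2-subgroup of the ideal class group of `K` is a perfect square. -/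
theorem card_sylow_two_classGroup_isSquare_of_cyclic_cubic
    (K : Type*) [Field K] [NumberField K] [IsGalois ℚ K]
    (hdeg : Module.finrank ℚ K = 3)
    (P : Sylow 2 (ClassGroup (𝓞 K))) :
    IsSquare (Nat.card (P : Subgroup (ClassGroup (𝓞 K)))) := by
  let := ClassGroup.mulDistribMulAction (S := 𝓞 K) Gal(K/ℚ)
  have hG : Nat.card Gal(K/ℚ) = 3 := hdeg ▸ IsGalois.card_aut_eq_finrank ℚ K
  have := P.characteristic_of_normal inferInstance
  let X : SubMulAction Gal(K/ℚ) (ClassGroup (𝓞 K)) :=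
    { carrier := P
      smul_mem' := fun g c hc ↦ by
        have h := Subgroup.Characteristic.fixed this
          (MulDistribMulAction.toMulEquiv _ g)
        exact h.symm.le hc }
  obtain ⟨n, hn⟩ := IsPGroup.iff_card.mp P.isPGroup'
  refine MulAction.isSquare_card_of_card_fixedPoints_eq_one (G := Gal(K/ℚ)) (α := X) hG hn ?_
  rw [Nat.card_eq_one_iff_unique]
  refine ⟨⟨fun x y ↦ ?_⟩, ⟨⟨⟨1, P.one_mem⟩, fun g ↦ Subtype.ext (smul_one g)⟩⟩⟩
  suffices h : ∀ z : MulAction.fixedPoints Gal(K/ℚ) X, (z : X).1 = 1 from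
    Subtype.ext (Subtype.ext ((h x).trans (h y).symm))
  intro z
  have h3 : (z : X).1 ^ 3 = 1 := by
    have h := ClassGroup.prod_smul_eq_one Gal(K/ℚ) ℤ (z : X).1
    have hz (g : Gal(K/ℚ)) : g • (z : X).1 = (z : X).1 := congrArg Subtype.val (z.2 g)
    rwa [Finset.prod_congr rfl fun g _ ↦ hz g, Finset.prod_const,
      Finset.card_univ, ← Nat.card_eq_fintype_card, hG] at h
  have hcop : (Nat.card P).Coprime 3 := hn ▸ Nat.Coprime.pow_left n (by decide)
  exact congrArg Subtype.val
    ((pow_eq_one_iff_of_coprime (a := (⟨(z : X).1, (z : X).2⟩ : P)) hcop).mp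
      ⟨pow_card_eq_one', Subtype.ext h3⟩)
end

section
/- Let G be a finite 2-group whose Frattini quotient G/Φ(G) has order 4 (equivalently, G is minimally generated by 2 elements), and let σ be an automorphism of G with σ³ = id and σ ≠ id. Then G has exactly three maximal subgroups, σ permutes them cyclically (in particular σ(M) ≠ M for every maximal subgroup M), and any two maximal subgroups of G are isomorphic. -/
open Subgroup

/-- A maximal subgroup of a finite `p`-group has index `p`. -/
theorem IsCoatom.index_eq_of_isPGroup {G : Type*} [Group G] [Finite G] {p : ℕ} [hp : Fact p.Prime]
    (hG : IsPGroup p G) {M : Subgroup G} (hM : IsCoatom M) : M.index = p := by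
  obtain ⟨k, hk⟩ := IsPGroup.iff_card.mp hG
  obtain ⟨n, hn⟩ := IsPGroup.iff_card.mp (hG.to_subgroup M)
  have hlt : n < k := by
    by_contra! h
    refine hM.1 (eq_top_of_le_card M ?_)
    rw [hn, hk]
    exact Nat.pow_le_pow_right hp.out.pos h
  obtain ⟨K, hK, hMK⟩ :=
    Sylow.exists_subgroup_card_pow_succ (hk ▸ pow_dvd_pow p hlt : p ^ (n + 1) ∣ Nat.card G) hn
  have hne : M ≠ K := by
    rintro rfl
    exact absurd (Nat.pow_right_injective hp.out.two_le (hn.symm.trans hK)) (by omega)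
  have hKtop : K = ⊤ := hM.2 K (lt_of_le_of_ne hMK hne)
  have hcard : Nat.card G = p ^ (n + 1) := by rw [← hK, hKtop, card_top]
  have hmul := M.card_mul_index
  rw [hcard, hn, pow_succ] at hmul
  exact Nat.eq_of_mul_eq_mul_left (pow_pos hp.out.pos n) hmul

/-- A self-map with trivial `p`-th iterate which preserves a finite set of cardinality prime to `p`
has a fixed point in that set. -/
theorem Set.MapsTo.exists_fixedPoint {α : Type*} {p : ℕ} [hp : Fact p.Prime] {f : α → α}
    (hf : ∀ x, f^[p] x = x) {s : Set α} [Finite s] (hs : Set.MapsTo f s s)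
    (hcard : ¬ p ∣ s.ncard) : ∃ x ∈ s, f x = x := by
  classical
  have := Fintype.ofFinite s
  let g : Function.End s := hs.restrict f s s
  have hg : g ^ p ^ 1 = 1 := by
    have hpow : g ^ p = g^[p] :=
      hom_coe_pow (fun e : Function.End s ↦ (e : s → s)) rfl (fun _ _ ↦ rfl) g p
    rw [pow_one, hpow]
    funext x
    exact Subtype.ext ((hs.coe_iterate_restrict x p).trans (hf x))
  have hmod := Equiv.Perm.card_fixedPoints_modEq hg
  have hpos : 0 < Fintype.card (Function.fixedPoints g) := by
    rw [Nat.pos_iff_ne_zero]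
    intro h0
    rw [h0] at hmod
    rw [← Nat.card_coe_set_eq, Nat.card_eq_fintype_card] at hcard
    exact hcard (Nat.modEq_zero_iff_dvd.mp hmod)
  obtain ⟨x, hx⟩ := Fintype.card_pos_iff.mp hpos
  exact ⟨x, x.2, congrArg Subtype.val hx⟩

section

variable {G : Type*} [Group G]

/-- If the Frattini quotient has order 4, a maximal subgroup of index 2 meets every other maximal
subgroup in the Frattini subgroup. -/
theorem inf_eq_frattini [Finite G] (hfrat : (frattini G).index = 4) {M N : Subgroup G}
    (hM : IsCoatom M) (hN : IsCoatom N) (hM2 : M.index = 2) (hne : M ≠ N) :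
    M ⊓ N = frattini G := by
  have hle : frattini G ≤ M ⊓ N := le_inf (frattini_le_coatom hM) (frattini_le_coatom hN)
  have hr : (M ⊓ N).relIndex M ≠ 1 := by
    rw [Ne, relIndex_eq_one]
    exact fun h ↦ hN.1 (hM.2 N (lt_of_le_of_ne (h.trans inf_le_right) hne))
  have hr0 : (M ⊓ N).relIndex M ≠ 0 := index_ne_zero_of_finite
  have hmul := relIndex_mul_index (inf_le_left : M ⊓ N ≤ M)
  rw [hM2] at hmul
  have h4 : 4 ≤ (M ⊓ N).index := by omega
  refine (eq_of_le_of_card_ge hle ?_).symm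
  have h1 := (M ⊓ N).card_mul_index
  have h2 := (frattini G).card_mul_index
  rw [hfrat] at h2
  nlinarith

/-- If three index 2 subgroups pairwise meet in the same subgroup, then the third consists of the
elements which lie in both or in neither of the first two. -/
theorem mem_iff_of_pairwise_inf_eq {M₁ M₂ N F : Subgroup G} (h₁ : M₁.index = 2)
    (h₂ : M₂.index = 2) (hN : N.index = 2) (hle : ¬ M₁ ≤ M₂) (h₁₂ : M₁ ⊓ M₂ = F)
    (h₁N : M₁ ⊓ N = F) (h₂N : M₂ ⊓ N = F) (x : G) : x ∈ N ↔ (x ∈ M₁ ↔ x ∈ M₂) := by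
  obtain ⟨m, hm₁, hm₂⟩ := SetLike.not_le_iff_exists.mp hle
  have e₁ := fun y ↦ SetLike.ext_iff.mp h₁₂ y
  have e₂ := fun y ↦ SetLike.ext_iff.mp h₁N y
  have e₃ := fun y ↦ SetLike.ext_iff.mp h₂N y
  simp only [mem_inf] at e₁ e₂ e₃
  have a₁ := mul_mem_iff_of_index_two h₁ (a := x) (b := m)
  have a₂ := mul_mem_iff_of_index_two h₂ (a := x) (b := m)
  have a₃ := mul_mem_iff_of_index_two hN (a := x) (b := m)
  grind

/-- There are at most three maximal subgroups in a finite 2-group with Frattini quotient of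
order 4. -/
theorem eq_of_isCoatom_of_ne [Finite G] (hG : IsPGroup 2 G) (hfrat : (frattini G).index = 4)
    {M₁ M₂ N₁ N₂ : Subgroup G} (hM₁ : IsCoatom M₁) (hM₂ : IsCoatom M₂) (hN₁ : IsCoatom N₁)
    (hN₂ : IsCoatom N₂) (hM : M₁ ≠ M₂) (h₁₁ : M₁ ≠ N₁) (h₂₁ : M₂ ≠ N₁) (h₁₂ : M₁ ≠ N₂)
    (h₂₂ : M₂ ≠ N₂) : N₁ = N₂ := by
  have hidx {K : Subgroup G} (hK : IsCoatom K) : K.index = 2 := hK.index_eq_of_isPGroup hG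
  have hinf {K L : Subgroup G} (hK : IsCoatom K) (hL : IsCoatom L) (h : K ≠ L) :
      K ⊓ L = frattini G := inf_eq_frattini hfrat hK hL (hidx hK) h
  have hle : ¬ M₁ ≤ M₂ := fun h ↦ hM₂.1 (hM₁.2 _ (lt_of_le_of_ne h hM))
  have key {N : Subgroup G} (hN : IsCoatom N) (h₁ : M₁ ≠ N) (h₂ : M₂ ≠ N) (x : G) :
      x ∈ N ↔ (x ∈ M₁ ↔ x ∈ M₂) :=
    mem_iff_of_pairwise_inf_eq (hidx hM₁) (hidx hM₂) (hidx hN) hle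
      (hinf hM₁ hM₂ hM) (hinf hM₁ hN h₁) (hinf hM₂ hN h₂) x
  ext x
  rw [key hN₁ h₁₁ h₂₁, key hN₂ h₁₂ h₂₂]

/-- An automorphism of order dividing 3 of a finite 2-group with Frattini quotient of order 4 is
trivial if it preserves a maximal subgroup. -/
theorem eq_one_of_map_isCoatom_eq [Finite G] (hG : IsPGroup 2 G)
    (hfrat : (frattini G).index = 4) {σ : MulAut G} (h3 : σ ^ 3 = 1) {M : Subgroup G}
    (hM : IsCoatom M) (hσM : M.map σ.toMonoidHom = M) : σ = 1 := by
  have hidx {K : Subgroup G} (hK : IsCoatom K) : K.index = 2 := hK.index_eq_of_isPGroup hG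
  have hiter (x : G) : σ^[3] x = x := DFunLike.congr_fun h3 x
  have hmem {K : Subgroup G} (hK : K.map σ.toMonoidHom = K) (x : G) : σ x ∈ K ↔ x ∈ K := by
    conv_lhs => rw [← hK]
    exact mem_map_iff_mem σ.injective
  have hσM' := hmem hσM
  have hσF := hmem (characteristic_iff_map_eq.mp (inferInstance : (frattini G).Characteristic) σ)
  have hFM : (frattini G : Set G) ⊆ M := frattini_le_coatom hM
  have cF : (frattini G : Set G).ncard * 4 = Nat.card G := hfrat ▸ (frattini G).card_mul_index
  have cM : (M : Set G).ncard * 2 = Nat.card G := hidx hM ▸ M.card_mul_index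
  have c3 : ¬ 3 ∣ Nat.card G := by
    obtain ⟨k, hk⟩ := IsPGroup.iff_card.mp hG
    rw [hk]
    exact fun h ↦ absurd (Nat.prime_three.dvd_of_dvd_pow h) (by norm_num)
  have cC := Set.ncard_add_ncard_compl (M : Set G)
  have cD := Set.ncard_sdiff_add_ncard_of_subset hFM
  obtain ⟨a, ha, haσ⟩ := Set.MapsTo.exists_fixedPoint (p := 3) hiter
    (s := (M : Set G)ᶜ) (fun x hx h ↦ hx ((hσM' x).mp h)) (by omega)
  obtain ⟨m, ⟨hmM, hmF⟩, hmσ⟩ := Set.MapsTo.exists_fixedPoint (p := 3) hiter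
    (s := (M : Set G) \ frattini G)
    (fun x hx ↦ ⟨(hσM' x).mpr hx.1, fun h ↦ hx.2 ((hσF x).mp h)⟩) (by omega)
  have htop : σ.toMonoidHom.eqLocus (MonoidHom.id G) = ⊤ := by
    rcases eq_top_or_exists_le_coatom (σ.toMonoidHom.eqLocus (MonoidHom.id G)) with h | ⟨N, hN, hle⟩
    · exact h
    · have hMN : M ≠ N := by
        rintro rfl
        exact ha (hle haσ)
      refine absurd ?_ hmF
      rw [← inf_eq_frattini hfrat hM hN (hidx hM) hMN]
      exact ⟨hmM, hle hmσ⟩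
  ext x
  exact (htop ▸ mem_top x : x ∈ σ.toMonoidHom.eqLocus (MonoidHom.id G))

end

/-- Let `G` be a finite 2-group whose Frattini quotient has order 4
(equivalently, `G` is minimally generated by 2 elements) and let `σ` be a
nontrivial automorphism of `G` with `σ³ = id`.  Then `G` has exactly three
maximal subgroups, `σ` permutes them cyclically (in particular it fixes none
of them), and any two maximal subgroups of `G` are isomorphic. -/
theorem maximal_subgroups_of_valid_two_group
    (G : Type*) [Group G] [Finite G] (hG : ∃ k : ℕ, Nat.card G = 2 ^ k)
    (hfrat : Nat.card (G ⧸ frattini G) = 4)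
    (σ : MulAut G) (h3 : σ ^ 3 = 1) (hne : σ ≠ 1) :
    Nat.card {M : Subgroup G // IsCoatom M} = 3 ∧
    (∀ M : Subgroup G, IsCoatom M → Subgroup.map σ.toMonoidHom M ≠ M) ∧
    (∀ M N : Subgroup G, IsCoatom M → IsCoatom N →
      N = M ∨ N = Subgroup.map σ.toMonoidHom M ∨
        N = Subgroup.map σ.toMonoidHom (Subgroup.map σ.toMonoidHom M)) ∧
    (∀ M N : Subgroup G, IsCoatom M → IsCoatom N → Nonempty (M ≃* N)) := by
  have hP : IsPGroup 2 G := IsPGroup.iff_card.mpr hG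
  let f : Subgroup G → Subgroup G := Subgroup.map σ.toMonoidHom
  have hf {M : Subgroup G} (hM : IsCoatom M) : IsCoatom (f M) :=
    (OrderIso.isCoatom_iff (MulEquiv.mapSubgroup σ) M).mpr hM
  have hfix (M : Subgroup G) (hM : IsCoatom M) : f M ≠ M :=
    fun h ↦ hne (eq_one_of_map_isCoatom_eq hP hfrat h3 hM h)
  have hf3 (M : Subgroup G) : f (f (f M)) = M := by
    ext x
    simp only [f, Subgroup.mem_map]
    have h (y : G) : σ (σ (σ y)) = y := DFunLike.congr_fun h3 y
    constructor
    · rintro ⟨_, ⟨_, ⟨y, hy, rfl⟩, rfl⟩, rfl⟩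
      exact (h y).symm ▸ hy
    · exact fun hx ↦ ⟨_, ⟨_, ⟨x, hx, rfl⟩, rfl⟩, h x⟩
  have hf2 (M : Subgroup G) (hM : IsCoatom M) : f (f M) ≠ M := by
    intro h
    have := hf3 M
    rw [h] at this
    exact hfix M hM this
  have horbit (M N : Subgroup G) (hM : IsCoatom M) (hN : IsCoatom N) :
      N = M ∨ N = f M ∨ N = f (f M) := by
    by_contra! h
    exact h.2.2 (eq_of_isCoatom_of_ne hP hfrat hM (hf hM) hN (hf (hf hM)) (hfix M hM).symm
      h.1.symm h.2.1.symm (hf2 M hM).symm (hfix _ (hf hM)).symm)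
  refine ⟨?_, hfix, horbit, ?_⟩
  · obtain ⟨M, hM⟩ : ∃ M : Subgroup G, IsCoatom M := by
      rcases eq_top_or_exists_le_coatom (frattini G) with h | ⟨M, hM, -⟩
      · have hidx : (frattini G).index = 4 := hfrat
        simp [h] at hidx
      · exact ⟨M, hM⟩
    have hset : {M : Subgroup G | IsCoatom M} = {M, f M, f (f M)} := by
      ext N
      refine ⟨horbit M N hM, ?_⟩
      rintro (rfl | rfl | rfl)
      exacts [hM, hf hM, hf (hf hM)]
    change Nat.card {M : Subgroup G | IsCoatom M} = 3
    rw [Nat.card_coe_set_eq, hset, Set.ncard_eq_three]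
    exact ⟨_, _, _, (hfix M hM).symm, (hf2 M hM).symm, (hfix _ (hf hM)).symm, rfl⟩
  · intro M N hM hN
    rcases horbit M N hM hN with rfl | rfl | rfl
    · exact ⟨MulEquiv.refl _⟩
    · exact ⟨σ.subgroupMap M⟩
    · exact ⟨(σ.subgroupMap M).trans (σ.subgroupMap (f M))⟩
end

section
/- For every integer n ≥ 1, the group G* presented on two generators x, y subject to the relations x^(2^(n+1)), y^(2^(n+1)), (x,y)², (x,(x,y)), (y,(x,y)), where (x,y) = x⁻¹y⁻¹xy denotes the commutator, has order 2^(2n+3). -/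
/-- The relations `x^(2^(n+1)), y^(2^(n+1)), (x,y)², (x,(x,y)), (y,(x,y))`,
where `(a,b) = a⁻¹b⁻¹ab` denotes the commutator. -/
def gStarRels (n : ℕ) : Set (FreeGroup (Fin 2)) :=
  let x : FreeGroup (Fin 2) := FreeGroup.of 0
  let y : FreeGroup (Fin 2) := FreeGroup.of 1
  let c : FreeGroup (Fin 2) := x⁻¹ * y⁻¹ * x * y
  {x ^ 2 ^ (n + 1), y ^ 2 ^ (n + 1), c ^ 2, x⁻¹ * c⁻¹ * x * c, y⁻¹ * c⁻¹ * y * c}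

/-- If the commutator `c` of `x` and `y` commutes with both, then moving powers of `y` past powers
of `x` only introduces a power of `c`. -/
theorem zpow_mul_zpow_of_commute_commutator {G : Type*} [Group G] {x y c : G}
    (hc : c = x⁻¹ * y⁻¹ * x * y) (hx : Commute x c) (hy : Commute y c) (i j : ℤ) :
    y ^ j * x ^ i = x ^ i * y ^ j * c ^ (-(i * j)) := by
  have h1 : y⁻¹ * x * y⁻¹⁻¹ = x * c := by rw [hc]; group
  have h2 : y⁻¹ * x ^ i * y⁻¹⁻¹ = x ^ i * c ^ i := by
    rw [← conj_zpow, h1, hx.mul_zpow]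
  have h3 : (x ^ i)⁻¹ * y * (x ^ i)⁻¹⁻¹ = y * c ^ (-i) := by
    have h4 : x ^ i * y = y * (x ^ i * c ^ i) := by rw [← h2]; group
    have h5 : y * x ^ i = x ^ i * y * c ^ (-i) := by
      rw [h4, zpow_neg]; group
    rw [inv_inv, mul_assoc, h5]; group
  have h6 : (x ^ i)⁻¹ * y ^ j * (x ^ i)⁻¹⁻¹ = y ^ j * c ^ (-(i * j)) := by
    rw [← conj_zpow, h3, (hy.zpow_right (-i)).mul_zpow, ← zpow_mul, neg_mul]
  rw [mul_assoc (x ^ i), ← h6]; group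

/-- A group generated by `x` and `y` whose commutator `c` is central consists of the elements
`x ^ i * y ^ j * c ^ k`. -/
theorem exists_eq_zpow_mul_zpow_mul_zpow {G : Type*} [Group G] {x y c : G}
    (hc : c = x⁻¹ * y⁻¹ * x * y) (hx : Commute x c) (hy : Commute y c)
    (hxy : Subgroup.closure {x, y} = ⊤) (g : G) :
    ∃ i j k : ℤ, g = x ^ i * y ^ j * c ^ k := by
  have key (i j k i' j' k' : ℤ) : x ^ i * y ^ j * c ^ k * (x ^ i' * y ^ j' * c ^ k') =
      x ^ (i + i') * y ^ (j + j') * c ^ (k + k' - i' * j) := by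
    have h1 : Commute (c ^ k) (x ^ i' * y ^ j') :=
      ((hx.zpow_zpow i' k).mul_left (hy.zpow_zpow j' k)).symm
    have h2 : Commute (c ^ (-(i' * j))) (y ^ j') := (hy.zpow_zpow _ _).symm
    calc x ^ i * y ^ j * c ^ k * (x ^ i' * y ^ j' * c ^ k')
        = x ^ i * y ^ j * (c ^ k * (x ^ i' * y ^ j')) * c ^ k' := by simp only [mul_assoc]
      _ = x ^ i * (y ^ j * x ^ i') * y ^ j' * c ^ k * c ^ k' := by
          rw [h1.eq]; simp only [mul_assoc]
      _ = x ^ i * x ^ i' * y ^ j * (c ^ (-(i' * j)) * y ^ j') * c ^ k * c ^ k' := by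
          rw [zpow_mul_zpow_of_commute_commutator hc hx hy]; simp only [mul_assoc]
      _ = _ := by
          rw [h2.eq, show k + k' - i' * j = -(i' * j) + k + k' by ring]
          simp only [zpow_add, mul_assoc]
  have hg : g ∈ Subgroup.closure {x, y} := hxy ▸ Subgroup.mem_top g
  induction hg using Subgroup.closure_induction with
  | mem g hg =>
    rcases hg with rfl | rfl
    · exact ⟨1, 0, 0, by simp⟩
    · exact ⟨0, 1, 0, by simp⟩
  | one => exact ⟨0, 0, 0, by simp⟩
  | mul _ _ _ _ h h' =>
    obtain ⟨i, j, k, rfl⟩ := h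
    obtain ⟨i', j', k', rfl⟩ := h'
    exact ⟨_, _, _, key ..⟩
  | inv _ _ h =>
    obtain ⟨i, j, k, rfl⟩ := h
    refine ⟨-i, -j, -k - i * j, inv_eq_of_mul_eq_one_right ?_⟩
    rw [key, show k + (-k - i * j) - -i * j = 0 by ring]
    simp

/-- The Heisenberg-type central extension of `R × R` by `S` with cocycle
`((a, b), (a', b')) ↦ f (b * a')`. -/
@[ext]
structure HeisenbergAlong {R S : Type*} [CommRing R] [CommRing S] (f : R →+* S) where
  /-- The first coordinate. -/
  fst : R
  /-- The second coordinate. -/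
  snd : R
  /-- The central coordinate. -/
  central : S

namespace HeisenbergAlong

variable {R S : Type*} [CommRing R] [CommRing S] {f : R →+* S}

instance : Mul (HeisenbergAlong f) :=
  ⟨fun u v => ⟨u.fst + v.fst, u.snd + v.snd, u.central + v.central + f (u.snd * v.fst)⟩⟩

instance : One (HeisenbergAlong f) := ⟨⟨0, 0, 0⟩⟩

instance : Inv (HeisenbergAlong f) :=
  ⟨fun u => ⟨-u.fst, -u.snd, -u.central + f (u.snd * u.fst)⟩⟩

theorem mul_def (u v : HeisenbergAlong f) :
    u * v = ⟨u.fst + v.fst, u.snd + v.snd, u.central + v.central + f (u.snd * v.fst)⟩ := rfl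

theorem one_def : (1 : HeisenbergAlong f) = ⟨0, 0, 0⟩ := rfl

theorem inv_def (u : HeisenbergAlong f) :
    u⁻¹ = ⟨-u.fst, -u.snd, -u.central + f (u.snd * u.fst)⟩ := rfl

instance : Group (HeisenbergAlong f) :=
  Group.ofLeftAxioms
    (fun u v w => by ext <;> simp only [mul_def, map_mul, map_add] <;> ring)
    (fun u => by ext <;> simp [mul_def, one_def])
    (fun u => by ext <;> simp [mul_def, one_def, inv_def])

theorem card_eq (f : R →+* S) :
    Nat.card (HeisenbergAlong f) = Nat.card R * Nat.card R * Nat.card S := by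
  rw [← Nat.card_prod, ← Nat.card_prod]
  exact Nat.card_congr
    { toFun := fun u => ((u.fst, u.snd), u.central)
      invFun := fun p => ⟨p.1.1, p.1.2, p.2⟩
      left_inv := fun _ => rfl
      right_inv := fun _ => rfl }

theorem mk_fst_zpow (a : R) (i : ℤ) : (⟨a, 0, 0⟩ : HeisenbergAlong f) ^ i = ⟨i * a, 0, 0⟩ := by
  let φ : Multiplicative R →* HeisenbergAlong f :=
    MonoidHom.mk' (fun r => ⟨r.toAdd, 0, 0⟩) fun r s => by ext <;> simp [mul_def]
  simpa [φ] using (map_zpow φ (Multiplicative.ofAdd a) i).symm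

theorem mk_snd_zpow (b : R) (i : ℤ) : (⟨0, b, 0⟩ : HeisenbergAlong f) ^ i = ⟨0, i * b, 0⟩ := by
  let φ : Multiplicative R →* HeisenbergAlong f :=
    MonoidHom.mk' (fun r => ⟨0, r.toAdd, 0⟩) fun r s => by ext <;> simp [mul_def]
  simpa [φ] using (map_zpow φ (Multiplicative.ofAdd b) i).symm

theorem mk_central_zpow (c : S) (i : ℤ) :
    (⟨0, 0, c⟩ : HeisenbergAlong f) ^ i = ⟨0, 0, i * c⟩ := by
  let φ : Multiplicative S →* HeisenbergAlong f :=
    MonoidHom.mk' (fun r => ⟨0, 0, r.toAdd⟩) fun r s => by ext <;> simp [mul_def]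
  simpa [φ] using (map_zpow φ (Multiplicative.ofAdd c) i).symm

theorem commutator_mk :
    (⟨1, 0, 0⟩ : HeisenbergAlong f)⁻¹ * ⟨0, 1, 0⟩⁻¹ * ⟨1, 0, 0⟩ * ⟨0, 1, 0⟩ = ⟨0, 0, -1⟩ := by
  ext <;> simp [mul_def, inv_def]

theorem zpow_mul_zpow_mul_zpow (i j k : ℤ) :
    (⟨1, 0, 0⟩ : HeisenbergAlong f) ^ i * ⟨0, 1, 0⟩ ^ j * ⟨0, 0, -1⟩ ^ k = ⟨i, j, -k⟩ := by
  rw [mk_fst_zpow, mk_snd_zpow, mk_central_zpow]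
  ext <;> simp [mul_def]

theorem relation_of_mem_gStarRels {n : ℕ} {f : ZMod (2 ^ (n + 1)) →+* ZMod 2} :
    ∀ r ∈ gStarRels n,
      FreeGroup.lift ![(⟨1, 0, 0⟩ : HeisenbergAlong f), ⟨0, 1, 0⟩] r = 1 := by
  have hN : ((2 : ZMod (2 ^ (n + 1))) ^ (n + 1)) = 0 := by
    exact_mod_cast ZMod.natCast_self (2 ^ (n + 1))
  have h2 : (2 : ZMod 2) = 0 := rfl
  rintro r (rfl | rfl | rfl | rfl | rfl) <;>
    simp only [map_mul, map_inv, map_pow, FreeGroup.lift_apply_of, Matrix.cons_val_zero,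
      Matrix.cons_val_one, commutator_mk]
  · rw [← zpow_natCast, mk_fst_zpow]; simp [hN, one_def]
  · rw [← zpow_natCast, mk_snd_zpow]; simp [hN, one_def]
  · rw [← zpow_natCast, mk_central_zpow]; simp [h2, one_def]
  · ext <;> simp [mul_def, inv_def, one_def, one_add_one_eq_two, h2]
  · ext <;> simp [mul_def, inv_def, one_def, one_add_one_eq_two, h2]

end HeisenbergAlong

/-- For every `n ≥ 1`, the group presented on two generators `x, y` subject to
the relations `x^(2^(n+1)), y^(2^(n+1)), (x,y)², (x,(x,y)), (y,(x,y))` has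
order `2^(2n+3)`. -/
theorem card_gStar (n : ℕ) (hn : 1 ≤ n) :
    Nat.card (PresentedGroup (gStarRels n)) = 2 ^ (2 * n + 3) := by
  let f : ZMod (2 ^ (n + 1)) →+* ZMod 2 := ZMod.castHom (dvd_pow_self 2 n.succ_ne_zero) _
  let x : PresentedGroup (gStarRels n) := PresentedGroup.of 0
  let y : PresentedGroup (gStarRels n) := PresentedGroup.of 1
  let c := x⁻¹ * y⁻¹ * x * y
  have rel {r : FreeGroup (Fin 2)} (hr : r ∈ gStarRels n) :
      PresentedGroup.mk (gStarRels n) r = 1 := PresentedGroup.one_of_mem hr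
  have hxN : x ^ 2 ^ (n + 1) = 1 := rel (.inl rfl)
  have hyN : y ^ 2 ^ (n + 1) = 1 := rel (.inr (.inl rfl))
  have hc2 : c ^ 2 = 1 := rel (.inr (.inr (.inl rfl)))
  have hxc : x⁻¹ * c⁻¹ * x * c = 1 := rel (.inr (.inr (.inr (.inl rfl))))
  have hyc : y⁻¹ * c⁻¹ * y * c = 1 := rel (.inr (.inr (.inr (.inr rfl))))
  have commute_of {a : PresentedGroup (gStarRels n)} (h : a⁻¹ * c⁻¹ * a * c = 1) :
      Commute a c := by
    rw [mul_assoc, ← mul_inv_rev, inv_mul_eq_one] at h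
    exact h.symm
  have hgen : Subgroup.closure {x, y} = ⊤ := by
    rw [← PresentedGroup.closure_range_of (gStarRels n)]
    congr 1
    ext g
    simp [Fin.exists_fin_two, x, y, eq_comm]
  let φ : PresentedGroup (gStarRels n) →* HeisenbergAlong f :=
    PresentedGroup.toGroup HeisenbergAlong.relation_of_mem_gStarRels
  have hφx : φ x = ⟨1, 0, 0⟩ := PresentedGroup.toGroup.of _
  have hφy : φ y = ⟨0, 1, 0⟩ := PresentedGroup.toGroup.of _
  have hφ (i j k : ℤ) : φ (x ^ i * y ^ j * c ^ k) = ⟨i, j, -k⟩ := by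
    simp only [c, map_mul, map_inv, map_zpow, hφx, hφy, HeisenbergAlong.commutator_mk,
      HeisenbergAlong.zpow_mul_zpow_mul_zpow]
  have hbij : Function.Bijective φ := by
    constructor
    · rw [injective_iff_map_eq_one]
      intro g hg
      obtain ⟨i, j, k, rfl⟩ :=
        exists_eq_zpow_mul_zpow_mul_zpow rfl (commute_of hxc) (commute_of hyc) hgen g
      rw [hφ, HeisenbergAlong.one_def, HeisenbergAlong.mk.injEq, neg_eq_zero,
        ZMod.intCast_zmod_eq_zero_iff_dvd, ZMod.intCast_zmod_eq_zero_iff_dvd,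
        ZMod.intCast_zmod_eq_zero_iff_dvd] at hg
      obtain ⟨⟨i, rfl⟩, ⟨j, rfl⟩, ⟨k, rfl⟩⟩ := hg
      change x ^ _ * y ^ _ * c ^ _ = 1
      simp only [zpow_mul, zpow_natCast, hxN, hyN, hc2, one_zpow, mul_one]
    · rintro ⟨a, b, d⟩
      obtain ⟨i, rfl⟩ := ZMod.intCast_surjective a
      obtain ⟨j, rfl⟩ := ZMod.intCast_surjective b
      obtain ⟨k, rfl⟩ := ZMod.intCast_surjective d
      exact ⟨x ^ i * y ^ j * c ^ (-k), by rw [hφ, Int.cast_neg, neg_neg]⟩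
  rw [Nat.card_eq_of_bijective φ hbij, HeisenbergAlong.card_eq, Nat.card_zmod, Nat.card_zmod]
  ring
end

section
/- Let G be a finite 2-group and define its 2-central series by P₀(G) = G and P_{n+1}(G) = P_n(G)² [G, P_n(G)]. If the quotient G/P₂(G) is isomorphic to the quaternion group Q₈ of order 8, then G itself is isomorphic to Q₈. -/
/-- The 2-central series of a group: `P 0 = G` and
`P (n+1) = P n ^ 2 [G, P n]`, the subgroup generated by the squares of
elements of `P n` together with commutators of elements of `G` with elements of `P n`. -/
def lowerTwoCentral (G : Type*) [Group G] : ℕ → Subgroup G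
  | 0 => ⊤
  | n + 1 =>
      Subgroup.closure {x : G | ∃ p ∈ lowerTwoCentral G n, x = p ^ 2} ⊔
        ⁅(⊤ : Subgroup G), lowerTwoCentral G n⁆

instance lowerTwoCentral_normal (G : Type*) [Group G] (n : ℕ) :
    (lowerTwoCentral G n).Normal := by
  induction n with
  | zero =>
      show (⊤ : Subgroup G).Normal
      infer_instance
  | succ n ih =>
      show (Subgroup.closure {x : G | ∃ p ∈ lowerTwoCentral G n, x = p ^ 2} ⊔
        ⁅(⊤ : Subgroup G), lowerTwoCentral G n⁆).Normal
      haveI := ih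
      haveI h1 : (Subgroup.closure
          {x : G | ∃ p ∈ lowerTwoCentral G n, x = p ^ 2}).Normal := by
        have hS : {x : G | ∃ p ∈ lowerTwoCentral G n, x = p ^ 2} =
            Group.conjugatesOfSet {x : G | ∃ p ∈ lowerTwoCentral G n, x = p ^ 2} := by
          refine Set.Subset.antisymm Group.subset_conjugatesOfSet fun a h => ?_
          simp_rw [Group.mem_conjugatesOfSet_iff, isConj_iff] at h
          obtain ⟨b, ⟨p, hp, rfl⟩, d, rfl⟩ := h
          refine ⟨d * p * d⁻¹, ih.conj_mem p hp d, ?_⟩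
          rw [pow_two, pow_two]
          group
        rw [hS]
        exact Subgroup.normalClosure_normal
      exact Subgroup.sup_normal _ _

/-- The maximal 2-class `n` quotient `Q_n(G) = G / P_n(G)`. -/
abbrev twoClassQuotient (G : Type*) [Group G] (n : ℕ) :=
  G ⧸ lowerTwoCentral G n

/-- In a nilpotent group of exponent dividing a power of `2`, the only subgroup `N` contained in
the subgroup generated by `⁅G, N⁆` and the squares of elements of `N` is the trivial one. -/
theorem eq_bot_of_le_closure_sq_sup_commutator {G : Type*} [Group G] [Group.IsNilpotent G]
    {k : ℕ} (hG : ∀ g : G, g ^ 2 ^ k = 1) (N : Subgroup G)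
    (hN : N ≤ Subgroup.closure {x : G | ∃ p ∈ N, x = p ^ 2} ⊔ ⁅(⊤ : Subgroup G), N⁆) :
    N = ⊥ := by
  refine Group.nilpotent_center_quotient_ind
    (P := fun G _ _ => (∀ g : G, g ^ 2 ^ k = 1) → ∀ N : Subgroup G,
      N ≤ Subgroup.closure {x : G | ∃ p ∈ N, x = p ^ 2} ⊔ ⁅(⊤ : Subgroup G), N⁆ → N = ⊥)
    G (fun G _ _ _ N _ => N.eq_bot_of_subsingleton) ?_ hG N (by exact hN)
  clear! G
  intro G _ _ ih hG N hN
  have hcentral : N ≤ Subgroup.center G := by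
    have hexp (q : G ⧸ Subgroup.center G) : q ^ 2 ^ k = 1 := by
      obtain ⟨g, rfl⟩ := QuotientGroup.mk'_surjective _ q
      rw [← map_pow, hG, map_one]
    have hbot := ih hexp (N.map (QuotientGroup.mk' (Subgroup.center G))) (by
      refine (Subgroup.map_mono hN).trans ?_
      rw [Subgroup.map_sup, Subgroup.map_commutator, MonoidHom.map_closure]
      refine sup_le_sup (Subgroup.closure_mono ?_) (Subgroup.commutator_mono le_top le_rfl)
      rintro _ ⟨_, ⟨p, hp, rfl⟩, rfl⟩
      exact ⟨_, Subgroup.mem_map_of_mem _ hp, map_pow _ _ _⟩)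
    rwa [Subgroup.map_eq_bot_iff, QuotientGroup.ker_mk'] at hbot
  have hcomm : ⁅(⊤ : Subgroup G), N⁆ = ⊥ := by
    rw [eq_bot_iff, Subgroup.commutator_le]
    intro g _ n hn
    rw [Subgroup.mem_bot, commutatorElement_eq_one_iff_mul_comm]
    exact Subgroup.mem_center_iff.1 (hcentral hn) g
  rw [hcomm, sup_bot_eq] at hN
  have hsq : ∀ n ∈ N, ∃ m ∈ N, n = m ^ 2 := by
    intro n hn
    replace hn := hN hn
    induction hn using Subgroup.closure_induction with
    | mem x hx => exact hx
    | one => exact ⟨1, N.one_mem, (one_pow 2).symm⟩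
    | mul x y _ _ hx hy =>
      obtain ⟨a, ha, rfl⟩ := hx
      obtain ⟨b, hb, rfl⟩ := hy
      have hab : Commute a b := Subgroup.mem_center_iff.1 (hcentral hb) a
      exact ⟨a * b, N.mul_mem ha hb, (hab.mul_pow 2).symm⟩
    | inv x _ hx =>
      obtain ⟨a, ha, rfl⟩ := hx
      exact ⟨a⁻¹, N.inv_mem ha, (inv_pow a 2).symm⟩
  have hpow : ∀ l : ℕ, ∀ n ∈ N, ∃ m ∈ N, n = m ^ 2 ^ l := by
    intro l
    induction l with
    | zero => exact fun n hn => ⟨n, hn, by simp⟩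
    | succ l ihl =>
      intro n hn
      obtain ⟨m, hm, rfl⟩ := ihl n hn
      obtain ⟨r, hr, rfl⟩ := hsq m hm
      exact ⟨r, hr, by rw [← pow_mul, pow_succ']⟩
  rw [Subgroup.eq_bot_iff_forall]
  intro n hn
  obtain ⟨m, -, rfl⟩ := hpow k n hn
  exact hG m

/-- If `G` maps onto the quaternion group with kernel `N`, and `π` sends `N` to central elements
of order dividing `2`, then `π` also does so for the preimage of the centre of the quaternion
group. -/
theorem sq_eq_one_and_commute_of_mem_center {G H : Type*} [Group G] [Group H]
    (f : G →* QuaternionGroup 2) (hf : Function.Surjective f) (π : G →* H)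
    (hsq : ∀ n ∈ f.ker, π n ^ 2 = 1) (hcomm : ∀ n ∈ f.ker, ∀ g, Commute (π n) (π g))
    {p : G} (hp : f p ∈ Subgroup.center (QuaternionGroup 2)) :
    π p ^ 2 = 1 ∧ ∀ g, Commute (π p) (π g) := by
  obtain ⟨x, hx⟩ := hf (QuaternionGroup.a 1)
  obtain ⟨y, hy⟩ := hf (QuaternionGroup.xa 0)
  have lift : ∀ u v : G, f u = f v → ∃ n ∈ f.ker, u = v * n := fun u v h =>
    ⟨v⁻¹ * u, by rw [MonoidHom.mem_ker, map_mul, map_inv, h, inv_mul_cancel], by group⟩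
  have hx2 : ∀ g, Commute (π x ^ 2) (π g) := by
    intro g
    have key : (∃ k : ℕ, f g = f x ^ k) ∨ f x ^ 2 = f g ^ 2 := by
      rw [hx]
      generalize f g = q
      have : ∀ q : QuaternionGroup 2, (∃ k ∈ Finset.range 4, q = QuaternionGroup.a 1 ^ k) ∨
          QuaternionGroup.a 1 ^ 2 = q ^ 2 := by decide
      exact (this q).imp_left fun ⟨k, _, h⟩ => ⟨k, h⟩
    rcases key with ⟨k, hk⟩ | hk
    · obtain ⟨n, hn, rfl⟩ := lift g (x ^ k) (by rw [hk, map_pow])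
      rw [map_mul, map_pow]
      refine Commute.mul_right ((Commute.refl _).pow_pow _ _) ?_
      rw [← map_pow]
      exact (hcomm n hn _).symm
    · obtain ⟨n, hn, h⟩ := lift (x ^ 2) (g ^ 2) (by rw [map_pow, map_pow, hk])
      rw [← map_pow, h, map_mul, map_pow]
      exact ((Commute.refl _).pow_left 2).mul_left (hcomm n hn g)
  have hx4 : (π x ^ 2) ^ 2 = 1 := by
    obtain ⟨n, hn, h⟩ := lift (y * x * y⁻¹) x⁻¹ (by
      simp only [map_mul, map_inv, hx, hy]; decide)
    have h1 : π y * π x ^ 2 * (π y)⁻¹ = (π x ^ 2)⁻¹ := by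
      have h2 := congrArg (fun g => π g ^ 2) h
      simp only [map_mul, map_inv, conj_pow] at h2
      rw [h2, ← map_inv, (hcomm n hn x⁻¹).symm.mul_pow, hsq n hn, mul_one, map_inv, inv_pow]
    rw [← (hx2 y).eq, mul_inv_cancel_right] at h1
    rw [pow_two (π x ^ 2)]
    nth_rewrite 1 [h1]
    exact inv_mul_cancel _
  have key : f p = 1 ∨ f p = f x ^ 2 := by
    rw [hx]
    rw [Subgroup.mem_center_iff] at hp
    revert hp
    generalize f p = q
    revert q
    decide
  rcases key with h | h
  · exact ⟨hsq p h, hcomm p h⟩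
  · obtain ⟨n, hn, rfl⟩ := lift p (x ^ 2) (by rw [h, map_pow])
    rw [map_mul, map_pow]
    refine ⟨?_, fun g => (hx2 g).mul_left (hcomm n hn g)⟩
    rw [(hx2 n).mul_pow, hx4, hsq n hn, one_mul]

/-- If `G` is a finite 2-group with `G/P₂(G) ≅ Q₈`, then `G ≅ Q₈`:
the quaternion group of order 8 has no proper descendants. -/
theorem eq_quaternion_of_twoClassQuotient_two_eq_quaternion
    (G : Type*) [Group G] [Finite G] (hG : ∃ k : ℕ, Nat.card G = 2 ^ k)
    (h : Nonempty (twoClassQuotient G 2 ≃* QuaternionGroup 2)) :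
    Nonempty (G ≃* QuaternionGroup 2) := by
  obtain ⟨e⟩ := h
  obtain ⟨k, hk⟩ := hG
  set f : G →* QuaternionGroup 2 :=
    e.toMonoidHom.comp (QuotientGroup.mk' (lowerTwoCentral G 2)) with hf
  have hker : f.ker = lowerTwoCentral G 2 := by
    ext g
    simp [hf]
  have hsurj : Function.Surjective f := e.surjective.comp (QuotientGroup.mk'_surjective _)
  have hcenter : ∀ p ∈ lowerTwoCentral G 1, f p ∈ Subgroup.center (QuaternionGroup 2) := by
    change lowerTwoCentral G 1 ≤ (Subgroup.center (QuaternionGroup 2)).comap f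
    refine sup_le ((Subgroup.closure_le _).2 ?_) (Subgroup.commutator_le.2 ?_)
    · rintro _ ⟨p, -, rfl⟩
      rw [SetLike.mem_coe, Subgroup.mem_comap, Subgroup.mem_center_iff, map_pow]
      generalize f p = q
      revert q
      decide
    · intro g _ p _
      rw [Subgroup.mem_comap, Subgroup.mem_center_iff, map_commutatorElement]
      generalize f p = q
      generalize f g = r
      revert q r
      decide
  set π := QuotientGroup.mk' (lowerTwoCentral G 3) with hπ
  have hsq : ∀ n ∈ f.ker, π n ^ 2 = 1 := by
    intro n hn
    rw [hker] at hn
    rw [← map_pow, hπ, QuotientGroup.mk'_apply, QuotientGroup.eq_one_iff]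
    exact Subgroup.mem_sup_left (Subgroup.subset_closure ⟨n, hn, rfl⟩)
  have hcomm : ∀ n ∈ f.ker, ∀ g, Commute (π n) (π g) := by
    intro n hn g
    rw [hker] at hn
    refine Commute.symm ?_
    rw [← commutatorElement_eq_one_iff_commute, ← map_commutatorElement, hπ,
      QuotientGroup.mk'_apply, QuotientGroup.eq_one_iff]
    exact Subgroup.mem_sup_right (Subgroup.commutator_mem_commutator (Subgroup.mem_top g) hn)
  have hle : lowerTwoCentral G 2 ≤ lowerTwoCentral G 3 := by
    rw [← QuotientGroup.ker_mk' (lowerTwoCentral G 3)]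
    refine sup_le ((Subgroup.closure_le _).2 ?_) (Subgroup.commutator_le.2 ?_)
    · rintro _ ⟨p, hp, rfl⟩
      rw [SetLike.mem_coe, MonoidHom.mem_ker, map_pow]
      exact (sq_eq_one_and_commute_of_mem_center f hsurj π hsq hcomm (hcenter p hp)).1
    · intro g _ p hp
      rw [MonoidHom.mem_ker, map_commutatorElement, commutatorElement_eq_one_iff_commute]
      exact ((sq_eq_one_and_commute_of_mem_center f hsurj π hsq hcomm (hcenter p hp)).2 g).symm
  have : Group.IsNilpotent G := (IsPGroup.of_card hk).isNilpotent
  have hbot : lowerTwoCentral G 2 = ⊥ :=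
    eq_bot_of_le_closure_sq_sup_commutator (fun g => hk ▸ pow_card_eq_one') _ hle
  exact ⟨(QuotientGroup.quotientBot.symm.trans
    (QuotientGroup.quotientMulEquivOfEq hbot.symm)).trans e⟩
end

section
/- Let G be a finite 2-group admitting an automorphism of order 3, and define its 2-central series by P₀(G) = G and P_{n+1}(G) = P_n(G)² [G, P_n(G)]. If G/P₂(G) is isomorphic to ℤ/4 × ℤ/4, then G is isomorphic to ℤ/2ⁿ × ℤ/2ⁿ for some n ≥ 2. -/
open scoped commutatorElement

section LowerTwoCentral

variable {G : Type*} [Group G]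

theorem lowerTwoCentral_succ_le {n : ℕ} {K : Subgroup G}
    (hsq : ∀ p ∈ lowerTwoCentral G n, p ^ 2 ∈ K)
    (hcomm : ∀ g : G, ∀ p ∈ lowerTwoCentral G n, ⁅g, p⁆ ∈ K) :
    lowerTwoCentral G (n + 1) ≤ K := by
  refine sup_le ?_ (Subgroup.commutator_le.2 fun g _ p hp => hcomm g p hp)
  rw [Subgroup.closure_le]
  rintro _ ⟨p, hp, rfl⟩
  exact hsq p hp

theorem sq_mem_lowerTwoCentral_succ {n : ℕ} {p : G} (hp : p ∈ lowerTwoCentral G n) :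
    p ^ 2 ∈ lowerTwoCentral G (n + 1) :=
  (le_sup_left : _ ≤ lowerTwoCentral G (n + 1)) (Subgroup.subset_closure ⟨p, hp, rfl⟩)

theorem commutatorElement_mem_lowerTwoCentral_succ {n : ℕ} (g : G) {p : G}
    (hp : p ∈ lowerTwoCentral G n) : ⁅g, p⁆ ∈ lowerTwoCentral G (n + 1) :=
  (le_sup_right : _ ≤ lowerTwoCentral G (n + 1))
    (Subgroup.commutator_mem_commutator (Subgroup.mem_top g) hp)

theorem map_mem_lowerTwoCentral {H : Type*} [Group H] (f : G →* H) {n : ℕ} :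
    ∀ {g : G}, g ∈ lowerTwoCentral G n → f g ∈ lowerTwoCentral H n := by
  induction n with
  | zero => intro _ _; exact Subgroup.mem_top _
  | succ n ih =>
    intro g hg
    refine lowerTwoCentral_succ_le (K := (lowerTwoCentral H (n + 1)).comap f) ?_ ?_ hg
    · intro p hp
      rw [Subgroup.mem_comap, map_pow]
      exact sq_mem_lowerTwoCentral_succ (ih hp)
    · intro g p hp
      rw [Subgroup.mem_comap, map_commutatorElement]
      exact commutatorElement_mem_lowerTwoCentral_succ _ (ih hp)

theorem lowerTwoCentral_two_le_one : lowerTwoCentral G 2 ≤ lowerTwoCentral G 1 :=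
  lowerTwoCentral_succ_le (fun _ _ => sq_mem_lowerTwoCentral_succ (Subgroup.mem_top _))
    fun g _ _ => commutatorElement_mem_lowerTwoCentral_succ g (Subgroup.mem_top _)

/-- The 2-central series of a finite 2-group reaches the trivial subgroup. -/
theorem exists_lowerTwoCentral_eq_bot (k : ℕ) :
    ∀ (G : Type*) [Group G], Nat.card G = 2 ^ k → ∃ n, lowerTwoCentral G n = ⊥ := by
  induction k with
  | zero =>
    intro G _ hG
    have : Subsingleton G := (Nat.card_eq_one_iff_unique.1 (by simpa using hG)).1
    exact ⟨0, Subsingleton.elim _ _⟩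
  | succ k ih =>
    intro G _ hG
    have : Finite G := Nat.finite_of_card_ne_zero (by rw [hG]; positivity)
    have hp : IsPGroup 2 G := IsPGroup.of_card hG
    have : Nontrivial G := by
      rw [← Finite.one_lt_card_iff_nontrivial, hG]
      exact Nat.one_lt_two_pow (by omega)
    have := hp.center_nontrivial
    obtain ⟨m, hm⟩ := IsPGroup.iff_card.1 (hp.to_subgroup (Subgroup.center G))
    have hm0 : m ≠ 0 := by
      rintro rfl
      have := Finite.one_lt_card (α := Subgroup.center G)
      omega
    obtain ⟨z, hz⟩ := exists_prime_orderOf_dvd_card' (G := Subgroup.center G) 2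
      (by rw [hm]; exact dvd_pow_self 2 hm0)
    have hzo : orderOf (z : G) = 2 := by rw [Subgroup.orderOf_coe, hz]
    have hle : Subgroup.zpowers (z : G) ≤ Subgroup.center G := by
      rw [Subgroup.zpowers_le]; exact z.2
    have hn : (Subgroup.zpowers (z : G)).Normal := ⟨fun p hp g => by
      rwa [Subgroup.mem_center_iff.1 (hle hp) g, mul_inv_cancel_right]⟩
    obtain ⟨n, hn⟩ := ih (G ⧸ Subgroup.zpowers (z : G)) (by
      have := Subgroup.card_eq_card_quotient_mul_card_subgroup (Subgroup.zpowers (z : G))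
      rw [Nat.card_zpowers, hzo, hG, pow_succ] at this
      omega)
    have hP : lowerTwoCentral G n ≤ Subgroup.zpowers (z : G) := by
      intro g hg
      have := map_mem_lowerTwoCentral (QuotientGroup.mk' (Subgroup.zpowers (z : G))) hg
      rw [hn, Subgroup.mem_bot] at this
      exact (QuotientGroup.eq_one_iff g).1 this
    refine ⟨n + 1, eq_bot_iff.2 (lowerTwoCentral_succ_le ?_ ?_)⟩
    · intro p hp
      obtain ⟨i, rfl⟩ := Subgroup.mem_zpowers_iff.1 (hP hp)
      have h2 : (z : G) ^ 2 = 1 := by rw [← hzo, pow_orderOf_eq_one]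
      rw [Subgroup.mem_bot, ← zpow_natCast, zpow_comm, zpow_natCast, h2, one_zpow]
    · intro g p hp
      rw [Subgroup.mem_bot, commutatorElement_eq_one_iff_mul_comm]
      exact Subgroup.mem_center_iff.1 (hle (hP hp)) g

/-- In a finite 2-group, `P₁` consists of non-generators. -/
theorem eq_top_of_sup_lowerTwoCentral_one {k : ℕ} (hG : Nat.card G = 2 ^ k) {F : Subgroup G}
    (hF : F ⊔ lowerTwoCentral G 1 = ⊤) : F = ⊤ := by
  have : Finite G := Nat.finite_of_card_ne_zero (by rw [hG]; positivity)
  by_contra hne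
  obtain ⟨m, hm⟩ := IsPGroup.iff_card.1 ((IsPGroup.of_card hG).to_subgroup F)
  have hlt : m < k := by
    have h1 : Nat.card F ≠ Nat.card G := fun h => hne (Subgroup.eq_top_of_card_eq F h)
    have h2 : Nat.card F ≤ Nat.card G := Subgroup.card_le_card_group F
    rw [hm, hG] at h1 h2
    exact (Nat.pow_lt_pow_iff_right (by norm_num)).1 (lt_of_le_of_ne h2 h1)
  obtain ⟨M, hM, hFM⟩ := Sylow.exists_subgroup_card_pow_prime_le (p := 2) (n := m) (m := k - 1)
    (by rw [hG]; exact pow_dvd_pow 2 (by omega)) F hm (by omega)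
  have hidx : M.index = 2 := by
    have := M.card_mul_index
    rw [hM, hG, show 2 ^ k = 2 ^ (k - 1) * 2 by rw [← pow_succ]; congr 1; omega] at this
    exact Nat.eq_of_mul_eq_mul_left (by positivity) this
  have hPM : lowerTwoCentral G 1 ≤ M := by
    refine lowerTwoCentral_succ_le (fun p _ => ?_) fun g p _ => ?_
    · rw [pow_two]; exact Subgroup.mul_self_mem_of_index_two hidx p
    · rw [commutatorElement_def, Subgroup.mul_mem_iff_of_index_two hidx,
        Subgroup.mul_mem_iff_of_index_two hidx, Subgroup.mul_mem_iff_of_index_two hidx,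
        inv_mem_iff, inv_mem_iff]
      tauto
  have : M = ⊤ := top_le_iff.1 (hF ▸ sup_le hFM hPM)
  rw [this, Subgroup.index_top] at hidx
  omega

/-- An automorphism of order dividing 3 of a finite 2-group which acts trivially modulo `P₁`
is trivial. -/
theorem eq_one_of_trivial_mod_lowerTwoCentral_one {k : ℕ} (hG : Nat.card G = 2 ^ k)
    (σ : MulAut G) (hσ : σ ^ 3 = 1) (h : ∀ g, g⁻¹ * σ g ∈ lowerTwoCentral G 1) : σ = 1 := by
  have : Finite G := Nat.finite_of_card_ne_zero (by rw [hG]; positivity)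
  have hσ3 : ∀ g, σ (σ (σ g)) = g := fun g => by
    have := DFunLike.congr_fun hσ g
    simpa [pow_succ] using this
  have key : ∀ g : G, ∃ p ∈ lowerTwoCentral G 1, σ (g * p) = g * p := by
    intro g
    let f : lowerTwoCentral G 1 → lowerTwoCentral G 1 := fun p =>
      ⟨g⁻¹ * σ (g * p), by
        rw [map_mul, ← mul_assoc]
        exact mul_mem (h g) (map_mem_lowerTwoCentral σ.toMonoidHom p.2)⟩
    have hf3 : f^[3] = id := by
      funext p
      apply Subtype.ext
      simp [f, hσ3]
    obtain ⟨m, hm⟩ := IsPGroup.iff_card.1 ((IsPGroup.of_card hG).to_subgroup (lowerTwoCentral G 1))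
    have hfp : (Function.fixedPoints f).Nonempty := by
      classical
      have := Fintype.ofFinite (lowerTwoCentral G 1)
      have hmod := Equiv.Perm.card_fixedPoints_modEq (p := 3) (n := 1) (f := f) hf3
      rw [← Nat.card_eq_fintype_card, hm] at hmod
      by_contra hempty
      rw [Set.not_nonempty_iff_eq_empty] at hempty
      simp only [hempty, Fintype.card_eq_zero] at hmod
      have := Nat.prime_three.dvd_of_dvd_pow ((Nat.modEq_zero_iff_dvd).1 hmod)
      omega
    obtain ⟨p, hp⟩ := hfp
    refine ⟨p, p.2, ?_⟩
    have := congrArg Subtype.val hp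
    simpa [f, inv_mul_eq_iff_eq_mul] using this
  have htop : (σ.toMonoidHom.eqLocus (MonoidHom.id G)) = ⊤ := by
    refine eq_top_of_sup_lowerTwoCentral_one hG (top_le_iff.1 fun g _ => ?_)
    obtain ⟨p, hp, hfix⟩ := key g
    rw [show g = g * p * p⁻¹ by group]
    exact Subgroup.mul_mem_sup hfix (inv_mem hp)
  ext g
  exact (htop ▸ Subgroup.mem_top g : g ∈ σ.toMonoidHom.eqLocus (MonoidHom.id G))

end LowerTwoCentral

/-- A group of class at most 2 and of 2-power exponent with elementary abelian derived subgroup contained in `P₂`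
is commutative if it has an endomorphism `τ` with `x * τ x * τ (τ x) ∈ P₁` for all `x` and is
generated by `x₀` and `τ x₀` for some `x₀`. -/
theorem mul_comm_of_commutatorElement_mem_lowerTwoCentral_two {H : Type*} [Group H] {k : ℕ}
    (hexp : ∀ g : H, g ^ 2 ^ k = 1) (τ : H →* H)
    (hcen : ∀ a b : H, ⁅a, b⁆ ∈ Subgroup.center H) (hsq : ∀ a b : H, ⁅a, b⁆ ^ 2 = 1)
    (hnorm : ∀ x : H, x * τ x * τ (τ x) ∈ lowerTwoCentral H 1)
    (hP : ∀ a b : H, ⁅a, b⁆ ∈ lowerTwoCentral H 2)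
    (x₀ : H) (hgen : Subgroup.closure {x₀, τ x₀} = ⊤) (a b : H) : a * b = b * a := by
  have hmul : ∀ a b : H, a * b = ⁅a, b⁆ * b * a := fun a b => by
    rw [commutatorElement_def]; group
  have hsqcen : ∀ a : H, a ^ 2 ∈ Subgroup.center H := by
    intro a
    rw [Subgroup.mem_center_iff]
    intro g
    have hc := Subgroup.mem_center_iff.1 (hcen g a)
    calc g * a ^ 2 = (g * a) * a := by rw [pow_two, mul_assoc]
      _ = ⁅g, a⁆ * a * g * a := by rw [← hmul]
      _ = ⁅g, a⁆ * a * (g * a) := mul_assoc _ _ _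
      _ = ⁅g, a⁆ * a * (⁅g, a⁆ * a * g) := by rw [← hmul]
      _ = ⁅g, a⁆ * (a * ⁅g, a⁆) * a * g := by simp only [mul_assoc]
      _ = ⁅g, a⁆ ^ 2 * (a ^ 2 * g) := by rw [hc a]; simp only [pow_two, mul_assoc]
      _ = a ^ 2 * g := by rw [hsq, one_mul]
  have hP1 : lowerTwoCentral H 1 ≤ Subgroup.center H :=
    lowerTwoCentral_succ_le (fun p _ => hsqcen p) fun g p _ => hcen g p
  have hcomm : ∀ a b : H, Commute (a ^ 2) b := fun a b =>
    (Subgroup.mem_center_iff.1 (hsqcen a) b).symm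
  have hpow4 : ∀ a b : H, (a * b) ^ 4 = a ^ 4 * b ^ 4 := by
    intro a b
    have hc := Subgroup.mem_center_iff.1 (hcen b a)
    have h2 : (a * b) ^ 2 = ⁅b, a⁆ * (a ^ 2 * b ^ 2) := by
      calc (a * b) ^ 2 = a * (b * a) * b := by simp only [pow_two, mul_assoc]
        _ = (a * ⁅b, a⁆) * a * b * b := by rw [hmul b a]; simp only [mul_assoc]
        _ = _ := by rw [hc a]; simp only [pow_two, mul_assoc]
    have hc' : Commute ⁅b, a⁆ (a ^ 2 * b ^ 2) := (hc _).symm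
    rw [show 4 = 2 * 2 from rfl, pow_mul, h2, hc'.mul_pow, hsq, one_mul,
      (hcomm a (b ^ 2)).mul_pow, ← pow_mul, ← pow_mul]
  have hpow : ∀ (m : ℕ) (a b : H), (a * b) ^ (4 * m) = a ^ (4 * m) * b ^ (4 * m) := by
    intro m a b
    have : Commute (a ^ 4) (b ^ 4) := by
      rw [show 4 = 2 * 2 from rfl, pow_mul]; exact (hcomm a _).pow_left 2
    rw [pow_mul, hpow4, this.mul_pow, ← pow_mul, ← pow_mul]
  let φ : ℕ → H →* H := fun m =>
    { toFun := fun a => a ^ (4 * m)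
      map_one' := one_pow _
      map_mul' := hpow m }
  have hP1pow : ∀ m, ∀ p ∈ lowerTwoCentral H 1, ∃ h, p ^ (4 * m) = h ^ (4 * (m * 2)) := by
    intro m p hp
    have : lowerTwoCentral H 1 ≤ (φ (m * 2)).range.comap (φ m) := by
      refine lowerTwoCentral_succ_le (fun p _ => ⟨p, ?_⟩) fun g p _ => ⟨1, ?_⟩
      · change p ^ (4 * (m * 2)) = (p ^ 2) ^ (4 * m)
        rw [← pow_mul]; congr 1; ring
      · change 1 ^ (4 * (m * 2)) = ⁅g, p⁆ ^ (4 * m)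
        rw [show 4 * m = 2 * (2 * m) by ring, pow_mul ⁅g, p⁆, hsq, one_pow, one_pow]
    obtain ⟨h, hh⟩ := this hp
    exact ⟨h, hh.symm⟩
  have hP2 : ∀ p ∈ lowerTwoCentral H 2, ∃ h, p = h ^ 4 := by
    intro p hp
    let K : Subgroup H :=
      { carrier := {p | p ∈ Subgroup.center H ∧ p ^ 2 ∈ (φ 1).range}
        one_mem' := ⟨one_mem _, by rw [one_pow]; exact one_mem _⟩
        mul_mem' := fun {p q} hp hq => ⟨mul_mem hp.1 hq.1, by
          rw [Commute.mul_pow (Subgroup.mem_center_iff.1 hq.1 p)]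
          exact mul_mem hp.2 hq.2⟩
        inv_mem' := fun {p} hp => ⟨inv_mem hp.1, by
          rw [inv_pow]
          exact inv_mem hp.2⟩ }
    have hP1K : lowerTwoCentral H 1 ≤ K :=
      lowerTwoCentral_succ_le (fun p _ => ⟨hsqcen p, p, (pow_mul p 2 2)⟩)
        fun g p _ => ⟨hcen g p, by rw [hsq]; exact one_mem _⟩
    have : lowerTwoCentral H 2 ≤ (φ 1).range := by
      refine lowerTwoCentral_succ_le (fun p hp => ?_) fun g p hp => ?_
      · exact (hP1K hp).2
      · rw [commutatorElement_eq_one_iff_mul_comm.2 (Subgroup.mem_center_iff.1 (hP1 hp) g)]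
        exact one_mem _
    obtain ⟨h, hh⟩ := this hp
    exact ⟨h, hh.symm⟩
  set y := τ x₀ with hy
  set z := ⁅x₀, y⁆ with hz
  have hzcen := Subgroup.mem_center_iff.1 (hcen x₀ y)
  have hτz : τ z = z := by
    have hp := Subgroup.mem_center_iff.1 (hP1 (hnorm x₀))
    set p := x₀ * τ x₀ * τ (τ x₀) with hpdef
    have hyy : τ y = (x₀ * y)⁻¹ * p := by rw [hpdef, ← hy]; group
    calc τ z = y * ((x₀ * y)⁻¹ * p) * y⁻¹ * ((x₀ * y)⁻¹ * p)⁻¹ := by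
          rw [hz, map_commutatorElement, commutatorElement_def, ← hy, hyy]
      _ = y * (x₀ * y)⁻¹ * (p * y⁻¹) * p⁻¹ * (x₀ * y) := by group
      _ = x₀⁻¹ * y⁻¹ * (x₀ * y) := by rw [← hp y⁻¹]; group
      _ = x₀⁻¹ * y⁻¹ * (y * x₀ * z) := by rw [hzcen, hmul x₀ y]; simp only [mul_assoc]
      _ = z := by group
  have hall : ∀ j : ℕ, ∃ g : H, z = g ^ (4 * 2 ^ j) := by
    intro j
    induction j with
    | zero => simpa using hP2 z (hP x₀ y)
    | succ j ih =>
      obtain ⟨g, hg⟩ := ih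
      obtain ⟨h, hh⟩ := hP1pow (2 ^ j) _ (hnorm g)
      refine ⟨h, ?_⟩
      rw [pow_succ, ← hh, hpow, hpow, ← map_pow, ← map_pow, ← map_pow, ← hg, hτz, hτz,
        ← pow_two, hsq, one_mul]
  have hz1 : z = 1 := by
    obtain ⟨g, hg⟩ := hall k
    rw [hg, mul_comm, pow_mul, hexp, one_pow]
  have hxy : x₀ * y = y * x₀ := commutatorElement_eq_one_iff_mul_comm.1 hz1
  have hc : (⊤ : Subgroup H) ≤ Subgroup.centralizer {x₀, y} := by
    rw [← hgen, Subgroup.closure_le]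
    rintro g (rfl | rfl) <;> rw [SetLike.mem_coe, Subgroup.mem_centralizer_iff] <;>
      rintro h (rfl | rfl) <;> simp [hxy]
  have hc' : (⊤ : Subgroup H) ≤ Subgroup.center H := by
    rw [← hgen, Subgroup.closure_le]
    intro g hg
    rw [SetLike.mem_coe, Subgroup.mem_center_iff]
    intro h
    exact (Subgroup.mem_centralizer_iff.1 (hc (Subgroup.mem_top h)) g hg).symm
  exact Subgroup.mem_center_iff.1 (hc' (Subgroup.mem_top b)) a

/-- A finite 2-group `G` with derived subgroup contained in `P₂(G)` is commutative if it has an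
endomorphism `τ` with `x * τ x * τ (τ x) ∈ P₁` for all `x` and is generated by `x₀` and `τ x₀`
for some `x₀`. -/
theorem mul_comm_of_card_eq_two_pow {G : Type*} [Group G] {k : ℕ} (hG : Nat.card G = 2 ^ k)
    (τ : G →* G) (hnorm : ∀ x : G, x * τ x * τ (τ x) ∈ lowerTwoCentral G 1)
    (hP : ∀ a b : G, ⁅a, b⁆ ∈ lowerTwoCentral G 2)
    (x₀ : G) (hgen : Subgroup.closure {x₀, τ x₀} = ⊤) (a b : G) : a * b = b * a := by
  let S : Set G := {g | ∃ a b : G, g = ⁅a, b⁆ ^ 2} ∪ {g | ∃ a b c : G, g = ⁅c, ⁅a, b⁆⁆}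
  let N := Subgroup.normalClosure S
  have hSN : S ⊆ N := Subgroup.subset_normalClosure
  have hNτ : N ≤ N.comap τ := by
    refine Subgroup.normalClosure_le_normal ?_
    rintro _ (⟨a, b, rfl⟩ | ⟨a, b, c, rfl⟩)
    · exact hSN (Or.inl ⟨τ a, τ b, by simp [map_commutatorElement]⟩)
    · exact hSN (Or.inr ⟨τ a, τ b, τ c, by simp [map_commutatorElement]⟩)
  let q := QuotientGroup.mk' N
  have hq : Function.Surjective q := QuotientGroup.mk'_surjective N
  have hqτ : ∀ x, QuotientGroup.map N N τ hNτ (q x) = q (τ x) := fun x => rfl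
  have hab : ∀ a b : G, q a * q b = q b * q a := fun a b => by
    refine mul_comm_of_commutatorElement_mem_lowerTwoCentral_two (k := k)
      ?_ (QuotientGroup.map N N τ hNτ) ?_ ?_ ?_ ?_ (q x₀) ?_ _ _
    · intro g
      obtain ⟨g, rfl⟩ := hq g
      rw [← map_pow, ← hG, pow_card_eq_one', map_one]
    · intro a b
      obtain ⟨a, rfl⟩ := hq a
      obtain ⟨b, rfl⟩ := hq b
      rw [Subgroup.mem_center_iff]
      intro c
      obtain ⟨c, rfl⟩ := hq c
      rw [← commutatorElement_eq_one_iff_mul_comm, ← map_commutatorElement,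
        ← map_commutatorElement]
      exact (QuotientGroup.eq_one_iff _).2 (hSN (Or.inr ⟨a, b, c, rfl⟩))
    · intro a b
      obtain ⟨a, rfl⟩ := hq a
      obtain ⟨b, rfl⟩ := hq b
      rw [← map_commutatorElement, ← map_pow]
      exact (QuotientGroup.eq_one_iff _).2 (hSN (Or.inl ⟨a, b, rfl⟩))
    · intro x
      obtain ⟨x, rfl⟩ := hq x
      rw [hqτ, hqτ, ← map_mul, ← map_mul]
      exact map_mem_lowerTwoCentral q (hnorm x)
    · intro a b
      obtain ⟨a, rfl⟩ := hq a
      obtain ⟨b, rfl⟩ := hq b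
      rw [← map_commutatorElement]
      exact map_mem_lowerTwoCentral q (hP a b)
    · rw [hqτ, ← Set.image_pair, ← MonoidHom.map_closure, hgen,
        Subgroup.map_top_of_surjective q hq]
  have hmem : ∀ n, ∀ a b : G, ⁅a, b⁆ ∈ lowerTwoCentral G n := by
    intro n
    induction n with
    | zero => intro a b; exact Subgroup.mem_top _
    | succ n ih =>
      intro a b
      have hN : N ≤ lowerTwoCentral G (n + 1) := by
        refine Subgroup.normalClosure_le_normal ?_
        rintro _ (⟨a, b, rfl⟩ | ⟨a, b, c, rfl⟩)
        · exact sq_mem_lowerTwoCentral_succ (ih a b)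
        · exact commutatorElement_mem_lowerTwoCentral_succ c (ih a b)
      refine hN ((QuotientGroup.eq_one_iff _).1 ?_)
      change q ⁅a, b⁆ = 1
      rw [map_commutatorElement, commutatorElement_eq_one_iff_mul_comm]
      exact hab a b
  obtain ⟨n, hn⟩ := exists_lowerTwoCentral_eq_bot k G hG
  rw [← commutatorElement_eq_one_iff_mul_comm, ← Subgroup.mem_bot, ← hn]
  exact hmem n a b

/-- In an abelian 2-group, an element `w` with `w * τ w * τ (τ w) = 1` satisfies no relation
`w ^ a * τ w ^ b = 1` with `a` or `b` odd, unless `w = 1`. -/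
theorem even_and_even_of_zpow_mul_zpow_eq_one {A : Type*} [CommGroup A] (hA : IsPGroup 2 A)
    (τ : A →* A) {w : A} (hw : w * τ w * τ (τ w) = 1) (hw1 : w ≠ 1) {a b : ℤ}
    (hab : w ^ a * τ w ^ b = 1) : 2 ∣ a ∧ 2 ∣ b := by
  by_contra hodd
  have hv : τ (τ w) = (w * τ w)⁻¹ := (inv_eq_of_mul_eq_one_right hw).symm
  have h2 := congrArg τ hab
  rw [map_mul, map_zpow, map_zpow, map_one, hv] at h2
  have hN : w ^ (a ^ 2 - a * b + b ^ 2) = 1 := by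
    have e1 : a • Additive.ofMul w + b • Additive.ofMul (τ w) = 0 := hab
    have e2 : a • Additive.ofMul (τ w) + b • -(Additive.ofMul w + Additive.ofMul (τ w)) = 0 := h2
    change (a ^ 2 - a * b + b ^ 2) • Additive.ofMul w = 0
    linear_combination (norm := module) (a - b) • e1 - b • e2
  obtain ⟨m, hm⟩ := hA w
  have hcop : IsCoprime (a ^ 2 - a * b + b ^ 2) ((2 ^ m : ℕ) : ℤ) := by
    push_cast
    refine IsCoprime.pow_right ?_
    refine ((Prime.coprime_iff_not_dvd Int.prime_two).2 fun hdvd => hodd ?_).symm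
    rw [← even_iff_two_dvd] at hdvd ⊢
    rw [← even_iff_two_dvd]
    simp only [parity_simps] at hdvd
    tauto
  obtain ⟨u, v, huv⟩ := hcop
  apply hw1
  rw [← zpow_one w, ← huv, zpow_add, mul_comm u, mul_comm v, zpow_mul, zpow_mul, hN,
    zpow_natCast, hm, one_zpow, one_zpow, one_mul]

/-- An abelian 2-group generated by `x` and `τ x`, for an endomorphism `τ` with
`x * τ x * τ (τ x) = 1`, is homocyclic of rank 2. -/
theorem exists_mulEquiv_zmod_two_pow_prod {A : Type*} [CommGroup A] (hA : IsPGroup 2 A)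
    (τ : A →* A) {x : A} (hx : x * τ x * τ (τ x) = 1)
    (hgen : Subgroup.closure {x, τ x} = ⊤) :
    ∃ n : ℕ, Nonempty (A ≃* Multiplicative (ZMod (2 ^ n) × ZMod (2 ^ n))) := by
  obtain ⟨n, hn⟩ := IsPGroup.iff_orderOf.1 hA x
  have hxn : x ^ 2 ^ n = 1 := by rw [← hn, pow_orderOf_eq_one]
  have hyn : τ x ^ 2 ^ n = 1 := by rw [← map_pow, hxn, map_one]
  have hdvd : ∀ a b : ℤ, x ^ a * τ x ^ b = 1 → ((2 ^ n : ℕ) : ℤ) ∣ a ∧ ((2 ^ n : ℕ) : ℤ) ∣ b := by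
    intro a b hab
    have : ∀ j ≤ n, ((2 ^ j : ℕ) : ℤ) ∣ a ∧ ((2 ^ j : ℕ) : ℤ) ∣ b := by
      intro j
      induction j with
      | zero => simp
      | succ j ih =>
        intro hj
        obtain ⟨⟨a', rfl⟩, b', rfl⟩ := ih (by omega)
        have hw1 : x ^ 2 ^ j ≠ 1 := by
          intro h
          have := orderOf_dvd_of_pow_eq_one h
          rw [hn, Nat.pow_dvd_pow_iff_le_right (by norm_num)] at this
          omega
        rw [zpow_mul, zpow_mul, zpow_natCast, zpow_natCast, ← map_pow] at hab
        obtain ⟨h1, h2⟩ := even_and_even_of_zpow_mul_zpow_eq_one hA τ (w := x ^ 2 ^ j)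
          (by rw [map_pow, map_pow, ← mul_pow, ← mul_pow, hx, one_pow]) hw1 hab
        rw [pow_succ, Nat.cast_mul]
        exact ⟨mul_dvd_mul_left _ h1, mul_dvd_mul_left _ h2⟩
    exact this n le_rfl
  let f (w : A) (hw : w ^ 2 ^ n = 1) : ZMod (2 ^ n) →+ Additive A :=
    ZMod.lift (2 ^ n) ⟨zmultiplesHom (Additive A) (Additive.ofMul w), by
      rw [zmultiplesHom_apply, natCast_zsmul, ← ofMul_pow, hw, ofMul_one]⟩
  have hf : ∀ w hw (a : ℤ), f w hw a = Additive.ofMul (w ^ a) := by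
    intro w hw a
    simp [f]
  let F : ZMod (2 ^ n) × ZMod (2 ^ n) →+ Additive A := (f x hxn).coprod (f (τ x) hyn)
  have hF : ∀ a b : ℤ, F (a, b) = Additive.ofMul (x ^ a * τ x ^ b) := by
    intro a b
    simp [F, hf]
  have hinj : Function.Injective F := by
    rw [injective_iff_map_eq_zero]
    rintro ⟨a, b⟩ h
    obtain ⟨a, rfl⟩ := ZMod.intCast_surjective a
    obtain ⟨b, rfl⟩ := ZMod.intCast_surjective b
    rw [hF] at h
    obtain ⟨h1, h2⟩ := hdvd a b (ofMul_eq_zero.1 h)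
    rw [Prod.mk_eq_zero, ZMod.intCast_zmod_eq_zero_iff_dvd, ZMod.intCast_zmod_eq_zero_iff_dvd]
    exact ⟨h1, h2⟩
  let F' : Multiplicative (ZMod (2 ^ n) × ZMod (2 ^ n)) →* A :=
    AddMonoidHom.toMultiplicativeLeft F
  have hsurj : Function.Surjective F' := by
    rw [← MonoidHom.range_eq_top, ← top_le_iff, ← hgen, Subgroup.closure_le]
    rintro _ (rfl | rfl)
    · exact ⟨Multiplicative.ofAdd (((1 : ℤ) : ZMod (2 ^ n)), ((0 : ℤ) : ZMod (2 ^ n))), by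
        change (F _).toMul = _
        erw [hF]
        simp only [zpow_one, zpow_zero, mul_one]
        rfl⟩
    · exact ⟨Multiplicative.ofAdd (((0 : ℤ) : ZMod (2 ^ n)), ((1 : ℤ) : ZMod (2 ^ n))), by
        change (F _).toMul = _
        erw [hF]
        simp only [zpow_one, zpow_zero, one_mul]
        rfl⟩
  exact ⟨n, ⟨(MulEquiv.ofBijective (M := Multiplicative (ZMod (2 ^ n) × ZMod (2 ^ n)))
    (N := A) F' ⟨hinj, hsurj⟩).symm⟩⟩

/-- If `G/P₂(G)` is isomorphic to `ℤ/4 × ℤ/4`, then `P₁(G)` is the kernel of a homomorphism to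
`ℤ/2 × ℤ/2`. -/
theorem exists_map_eq_one_iff_mem_lowerTwoCentral_one {G : Type*} [Group G]
    (e : twoClassQuotient G 2 ≃* Multiplicative (ZMod 4 × ZMod 4)) :
    ∃ π : G →* Multiplicative (ZMod 2 × ZMod 2),
      ∀ g, π g = 1 ↔ g ∈ lowerTwoCentral G 1 := by
  let r : ZMod 4 →+ ZMod 2 := (ZMod.castHom (by norm_num : 2 ∣ 4) (ZMod 2)).toAddMonoidHom
  let ρ : Multiplicative (ZMod 4 × ZMod 4) →* Multiplicative (ZMod 2 × ZMod 2) :=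
    AddMonoidHom.toMultiplicative (r.prodMap r)
  have hρsq : ∀ v, ρ v = 1 → ∃ u, v = u ^ 2 := by decide
  have hq : Function.Surjective (QuotientGroup.mk' (lowerTwoCentral G 2)) :=
    QuotientGroup.mk'_surjective _
  refine ⟨(ρ.comp e.toMonoidHom).comp (QuotientGroup.mk' (lowerTwoCentral G 2)),
    fun g => ⟨fun hg => ?_, fun hg => ?_⟩⟩
  · obtain ⟨u, hu⟩ := hρsq _ hg
    obtain ⟨h, rfl⟩ := (e.surjective.comp hq) u
    have : QuotientGroup.mk' (lowerTwoCentral G 2) g =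
        QuotientGroup.mk' (lowerTwoCentral G 2) (h ^ 2) := by
      apply e.injective
      rw [map_pow, map_pow]
      exact hu
    obtain ⟨p, hp, rfl⟩ := (QuotientGroup.mk'_eq_mk' _).1 this.symm
    exact mul_mem (sq_mem_lowerTwoCentral_succ (Subgroup.mem_top h))
      (lowerTwoCentral_two_le_one hp)
  · refine lowerTwoCentral_succ_le (K := MonoidHom.ker _) (fun p _ => ?_) (fun g p _ => ?_) hg
    · rw [MonoidHom.mem_ker, map_pow]
      exact (by decide : ∀ v : Multiplicative (ZMod 2 × ZMod 2), v ^ 2 = 1) _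
    · rw [MonoidHom.mem_ker, map_commutatorElement, commutatorElement_eq_one_iff_mul_comm,
        mul_comm]

/-- If `G/P₂(G)` is isomorphic to `ℤ/4 × ℤ/4`, then an automorphism of order 3 of the finite
2-group `G` acts on `G/P₁(G)` without nontrivial fixed points, hence its norm map is trivial
there, and any `x ∉ P₁(G)` generates `G` together with its image. -/
theorem norm_mem_and_closure_eq_top {G : Type*} [Group G] {k : ℕ} (hG : Nat.card G = 2 ^ k)
    (σ : MulAut G) (hσ : orderOf σ = 3)
    (e : twoClassQuotient G 2 ≃* Multiplicative (ZMod 4 × ZMod 4)) :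
    (∀ x, x * σ x * σ (σ x) ∈ lowerTwoCentral G 1) ∧
      (∀ x, x ∉ lowerTwoCentral G 1 → Subgroup.closure {x, σ x} = ⊤) ∧
      ∃ x, x⁻¹ * σ x ∉ lowerTwoCentral G 1 := by
  obtain ⟨π, hker⟩ := exists_map_eq_one_iff_mem_lowerTwoCentral_one e
  have hσ' : σ ^ 3 = 1 := by rw [← hσ, pow_orderOf_eq_one]
  have hσ3 : ∀ g, σ (σ (σ g)) = g := fun g => by
    have := DFunLike.congr_fun hσ' g
    simpa [pow_succ] using this
  have heq : ∀ a b, π a = π b ↔ a⁻¹ * b ∈ lowerTwoCentral G 1 := fun a b => by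
    rw [← hker, map_mul, map_inv, inv_mul_eq_one]
  have hcongr : ∀ a b, π a = π b → π (σ a) = π (σ b) := fun a b h => by
    rw [heq] at h ⊢
    simpa using map_mem_lowerTwoCentral σ.toMonoidHom h
  obtain ⟨g, hg⟩ : ∃ x, x⁻¹ * σ x ∉ lowerTwoCentral G 1 := by
    by_contra! h
    have := eq_one_of_trivial_mod_lowerTwoCentral_one hG σ hσ' h
    rw [this, orderOf_one] at hσ
    omega
  have hg' : π g ≠ π (σ g) := fun h => hg ((heq _ _).1 h)
  have h12 : π (σ g) ≠ π (σ (σ g)) := fun h => hg' (by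
    have := hcongr _ _ (hcongr _ _ h)
    rwa [hσ3] at this)
  have h20 : π (σ (σ g)) ≠ π g := fun h => hg' (by
    have := hcongr _ _ h
    rwa [hσ3] at this)
  have hne : ∀ a, π a = 1 ↔ π (σ a) = 1 := by
    intro a
    constructor
    · intro h
      simpa using hcongr a 1 (by simpa using h)
    · intro h
      have := hcongr _ _ (hcongr (σ a) 1 (by simpa using h))
      simpa [hσ3] using this
  have hg0 : π g ≠ 1 := fun h => hg' (by rw [h, (hne g).1 h])
  have hg1 : π (σ g) ≠ 1 := fun h => hg0 ((hne g).2 h)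
  have hg2 : π (σ (σ g)) ≠ 1 := fun h => hg1 ((hne _).2 h)
  have hV : ∀ a b c d : Multiplicative (ZMod 2 × ZMod 2), a ≠ 1 → b ≠ 1 → c ≠ 1 →
      a ≠ b → b ≠ c → c ≠ a → a * b * c = 1 ∧ (d = 1 ∨ d = a ∨ d = b ∨ d = c) := by
    set_option synthInstance.maxSize 100000 in
    decide
  have hN := fun d => hV _ _ _ d hg0 hg1 hg2 hg' h12 h20
  have hnorm : ∀ x, π x * π (σ x) * π (σ (σ x)) = 1 := by
    intro x
    rcases (hN (π x)).2 with h | h | h | h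
    · rw [h, (hne x).1 h, (hne _).1 ((hne x).1 h)]; rfl
    · rw [h, hcongr _ _ h, hcongr _ _ (hcongr _ _ h)]; exact (hN 1).1
    · rw [h, hcongr _ _ h, hcongr _ _ (hcongr _ _ h), hσ3, mul_comm, ← mul_assoc]
      exact (hN 1).1
    · rw [h, hcongr _ _ h, hcongr _ _ (hcongr _ _ h), hσ3, mul_assoc, mul_comm]
      exact (hN 1).1
  refine ⟨fun x => ?_, fun x hx => ?_, g, hg⟩
  · rw [← hker, map_mul, map_mul]; exact hnorm x
  · refine eq_top_of_sup_lowerTwoCentral_one hG (top_le_iff.1 fun u _ => ?_)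
    have hV' : ∀ a b c d : Multiplicative (ZMod 2 × ZMod 2), a ≠ 1 → b ≠ 1 → c ≠ 1 →
      a * b * c = 1 → d = 1 ∨ d = a ∨ d = b ∨ d = a * b := by
      set_option synthInstance.maxSize 100000 in
      decide
    rw [← hker] at hx
    have hx1 : π (σ x) ≠ 1 := fun h => hx ((hne x).2 h)
    have hx2 : π (σ (σ x)) ≠ 1 := fun h => hx1 ((hne _).2 h)
    have hxm : x ∈ Subgroup.closure {x, σ x} := Subgroup.subset_closure (by simp)
    have hym : σ x ∈ Subgroup.closure {x, σ x} := Subgroup.subset_closure (by simp)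
    obtain ⟨c, hc, hcu⟩ : ∃ c ∈ Subgroup.closure {x, σ x}, π c = π u := by
      rcases hV' _ _ _ (π u) hx hx1 hx2 (hnorm x) with h | h | h | h
      · exact ⟨1, one_mem _, by rw [h, map_one]⟩
      · exact ⟨x, hxm, h.symm⟩
      · exact ⟨σ x, hym, h.symm⟩
      · exact ⟨x * σ x, mul_mem hxm hym, by rw [h, map_mul]⟩
    rw [show u = c * (c⁻¹ * u) by group]
    exact Subgroup.mul_mem_sup hc ((heq _ _).1 hcu)

/-- If `G` is a finite 2-group admitting an automorphism of order 3 and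
`G/P₂(G) ≅ ℤ/4 × ℤ/4`, then `G ≅ ℤ/2ⁿ × ℤ/2ⁿ` for some `n ≥ 2`. -/
theorem eq_homocyclic_of_twoClassQuotient_two_eq
    (G : Type*) [Group G] [Finite G] (hG : ∃ k : ℕ, Nat.card G = 2 ^ k)
    (σ : MulAut G) (hσ : orderOf σ = 3)
    (h : Nonempty (twoClassQuotient G 2 ≃* Multiplicative (ZMod 4 × ZMod 4))) :
    ∃ n : ℕ, 2 ≤ n ∧
      Nonempty (G ≃* Multiplicative (ZMod (2 ^ n) × ZMod (2 ^ n))) := by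
  obtain ⟨k, hk⟩ := hG
  obtain ⟨e⟩ := h
  obtain ⟨hnorm, hgen, g, hg⟩ := norm_mem_and_closure_eq_top hk σ hσ e
  have hP : ∀ a b : G, ⁅a, b⁆ ∈ lowerTwoCentral G 2 := by
    intro a b
    rw [← QuotientGroup.ker_mk' (lowerTwoCentral G 2), MonoidHom.mem_ker, map_commutatorElement,
      commutatorElement_eq_one_iff_mul_comm]
    apply e.injective
    rw [map_mul, map_mul, mul_comm]
  have hcomm := mul_comm_of_card_eq_two_pow hk σ.toMonoidHom hnorm hP _ (hgen _ hg)
  have hσ3 : σ (σ (σ g)) = g := by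
    have := DFunLike.congr_fun (hσ ▸ pow_orderOf_eq_one σ : σ ^ 3 = 1) g
    simpa [pow_succ] using this
  have hx : g⁻¹ * σ g * σ (g⁻¹ * σ g) * σ (σ (g⁻¹ * σ g)) = 1 := by
    simp only [map_mul, map_inv, hσ3]
    group
  let _ : CommGroup G := { ‹Group G› with mul_comm := hcomm }
  obtain ⟨n, ⟨E⟩⟩ := exists_mulEquiv_zmod_two_pow_prod (IsPGroup.of_card hk) σ.toMonoidHom hx
    (hgen _ hg)
  refine ⟨n, ?_, ⟨E⟩⟩
  have h1 : Nat.card (twoClassQuotient G 2) = 16 := by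
    rw [Nat.card_congr e.toEquiv]
    simp [Nat.card_eq_fintype_card]
  have h2 : Nat.card G = 2 ^ n * 2 ^ n := by
    rw [Nat.card_congr E.toEquiv]
    simp
  have h3 : Nat.card (twoClassQuotient G 2) ∣ Nat.card G := Subgroup.card_quotient_dvd_card _
  rw [h1, h2] at h3
  by_contra! hn
  interval_cases n <;> omega
end

section
/- Let φ : ℤ/3 → Aut(ℤ/4 × ℤ/4) be an injective homomorphism and let G = (ℤ/4 × ℤ/4) ⋊_φ ℤ/3 be the corresponding semidirect product (a group of order 48). Then the Schur multiplier of G is cyclic of order 4; equivalently, the second cohomology group H²(G, ℂˣ) with trivial G-action on ℂˣ is isomorphic to ℤ/4. -/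
open groupCohomology

section Cocycles

variable {G N A : Type*} [Group G] [Group N] [AddCommGroup A]

/-- The 2-cocycle condition for the trivial action of `G` on `A`. -/
def IsTrivialCocycle₂ (f : G × G → A) : Prop :=
  ∀ x y z, f (x * y, z) + f (x, y) = f (y, z) + f (x, y * z)

variable (G A) in
/-- The 2-coboundaries for the trivial action of `G` on `A`. -/
def trivialCoboundaries₂ : AddSubgroup (G × G → A) where
  carrier := {f | ∃ u : G → A, ∀ x y, f (x, y) = u y - u (x * y) + u x}
  zero_mem' := ⟨0, by simp⟩
  add_mem' := by
    rintro f g ⟨u, hu⟩ ⟨v, hv⟩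
    exact ⟨u + v, fun x y ↦ by simp only [Pi.add_apply, hu, hv]; abel⟩
  neg_mem' := by
    rintro f ⟨u, hu⟩
    exact ⟨-u, fun x y ↦ by simp only [Pi.neg_apply, hu]; abel⟩

theorem mem_cocycles₂_trivial_iff {G A : Type} [Group G] [AddCommGroup A] {f : G × G → A} :
    f ∈ cocycles₂ (Rep.trivial ℤ G A) ↔ IsTrivialCocycle₂ f :=
  mem_cocycles₂_iff (A := Rep.trivial ℤ G A) f

theorem mem_coboundaries₂_trivial_iff {G A : Type} [Group G] [AddCommGroup A] {f : G × G → A} :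
    f ∈ coboundaries₂ (Rep.trivial ℤ G A) ↔ f ∈ trivialCoboundaries₂ G A :=
  exists_congr fun _ ↦ ⟨fun h _ _ ↦ by rw [← h]; rfl, fun h ↦ funext fun ⟨x, y⟩ ↦ (h x y).symm⟩

theorem IsTrivialCocycle₂.add {f g : G × G → A} (hf : IsTrivialCocycle₂ f)
    (hg : IsTrivialCocycle₂ g) : IsTrivialCocycle₂ (f + g) := fun x y z ↦ by
  simp only [Pi.add_apply]
  rw [add_add_add_comm, hf, hg, add_add_add_comm]

theorem IsTrivialCocycle₂.of_mem_trivialCoboundaries₂ {f : G × G → A}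
    (hf : f ∈ trivialCoboundaries₂ G A) : IsTrivialCocycle₂ f := by
  obtain ⟨u, hu⟩ := hf
  intro x y z
  simp only [hu, mul_assoc]
  abel

theorem IsTrivialCocycle₂.comp {f : G × G → A} (hf : IsTrivialCocycle₂ f) (i : N →* G) :
    IsTrivialCocycle₂ (f ∘ Prod.map i i) := fun x y z ↦ by
  simpa using hf (i x) (i y) (i z)

theorem IsTrivialCocycle₂.one_left {f : G × G → A} (hf : IsTrivialCocycle₂ f) (x : G) :
    f (1, x) = f (1, 1) := by
  simpa using (hf 1 1 x).symm

/-- A cocycle vanishing on `G × H` is annihilated by the index of `H`, up to coboundaries. -/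
theorem IsTrivialCocycle₂.index_nsmul_mem_of_eq_zero {f : G × G → A} (hf : IsTrivialCocycle₂ f)
    (H : Subgroup G) [H.FiniteIndex] (h0 : ∀ g, ∀ m ∈ H, f (g, m) = 0) :
    H.index • f ∈ trivialCoboundaries₂ G A := by
  classical
  have := H.fintypeQuotientOfFiniteIndex
  have inv (x y m : G) (hm : m ∈ H) : f (x, y * m) = f (x, y) := by
    have := hf x y m
    rw [h0 _ m hm, h0 _ m hm] at this
    simpa using this.symm
  refine ⟨fun x ↦ ∑ q : G ⧸ H, f (x, q.out), fun x y ↦ ?_⟩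
  have key (q : G ⧸ H) : f (x, y * q.out) = f (x, (y • q).out) := by
    have hq : ((y • q).out : G ⧸ H) = ((y * q.out : G) : G ⧸ H) := by
      rw [QuotientGroup.out_eq', ← smul_eq_mul, ← MulAction.Quotient.smul_coe,
        QuotientGroup.out_eq']
    have := inv x (y • q).out _ (QuotientGroup.eq.1 hq)
    rwa [mul_inv_cancel_left] at this
  have hsum : ∑ q : G ⧸ H, f (x, y * q.out) = ∑ q : G ⧸ H, f (x, q.out) := by
    simp_rw [key]
    exact Equiv.sum_comp (MulAction.toPerm y) fun q : G ⧸ H ↦ f (x, q.out)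
  have hcoc : ∑ q : G ⧸ H, (f (x * y, q.out) + f (x, y)) =
      ∑ q : G ⧸ H, (f (y, q.out) + f (x, y * q.out)) :=
    Finset.sum_congr rfl fun q _ ↦ hf x y q.out
  rw [Finset.sum_add_distrib, Finset.sum_add_distrib, hsum, Finset.sum_const, Finset.card_univ,
    ← Nat.card_eq_fintype_card] at hcoc
  change H.index • f (x, y) = _
  rw [sub_add_eq_add_sub, ← hcoc, add_sub_cancel_left]
  rfl

/-- A cocycle whose restriction to `H` is a coboundary is cohomologous to one vanishing
on `G × H`. -/
theorem IsTrivialCocycle₂.exists_eq_zero {f : G × G → A} (hf : IsTrivialCocycle₂ f)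
    (H : Subgroup G) (u : G → A)
    (hu : ∀ x ∈ H, ∀ y ∈ H, f (x, y) = u y - u (x * y) + u x) :
    ∃ f', IsTrivialCocycle₂ f' ∧ f' - f ∈ trivialCoboundaries₂ G A ∧
      ∀ g, ∀ m ∈ H, f' (g, m) = 0 := by
  set e : G × G → A := fun p ↦ f p - (u p.2 - u (p.1 * p.2) + u p.1) with he_def
  have hd : (fun p : G × G ↦ -(u p.2 - u (p.1 * p.2) + u p.1)) ∈ trivialCoboundaries₂ G A :=
    (trivialCoboundaries₂ G A).neg_mem' (x := fun p ↦ u p.2 - u (p.1 * p.2) + u p.1)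
      ⟨u, fun _ _ ↦ rfl⟩
  have he : IsTrivialCocycle₂ e := by
    convert hf.add (.of_mem_trivialCoboundaries₂ hd) using 1
    ext p; simp [e, sub_eq_add_neg]
  have he0 (x) (hx : x ∈ H) (y) (hy : y ∈ H) : e (x, y) = 0 := by simp [e, hu x hx y hy]
  let t (g : G) : G := (g : G ⧸ H).out
  have ht (g : G) : (t g)⁻¹ * g ∈ H := QuotientGroup.eq.1 (QuotientGroup.out_eq' _)
  let v (g : G) : A := e (t g, (t g)⁻¹ * g)
  have hv : (fun p : G × G ↦ v p.2 - v (p.1 * p.2) + v p.1) ∈ trivialCoboundaries₂ G A :=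
    ⟨v, fun _ _ ↦ rfl⟩
  refine ⟨e + fun p ↦ v p.2 - v (p.1 * p.2) + v p.1,
    he.add (.of_mem_trivialCoboundaries₂ hv), ?_, fun g m hm ↦ ?_⟩
  · convert add_mem hd hv using 1
    ext p; simp only [e, Pi.sub_apply, Pi.add_apply]; abel
  · have htm : t (g * m) = t g := by
      simp only [t]
      rw [QuotientGroup.mk_mul_of_mem g hm]
    have hvm : v m = 0 := by
      have htH : t m ∈ H := by simpa using H.mul_mem hm (H.inv_mem (ht m))
      exact he0 _ htH _ (ht m)
    have := he (t g) ((t g)⁻¹ * g) m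
    rw [he0 _ (ht g) m hm, mul_inv_cancel_left, zero_add, mul_assoc] at this
    simp only [Pi.add_apply, hvm, v, htm]
    rw [zero_sub, ← this]
    abel

theorem IsTrivialCocycle₂.index_nsmul_mem {f : G × G → A} (hf : IsTrivialCocycle₂ f)
    (i : N →* G) (hi : Function.Injective i) [i.range.FiniteIndex]
    (h : f ∘ Prod.map i i ∈ trivialCoboundaries₂ N A) :
    i.range.index • f ∈ trivialCoboundaries₂ G A := by
  obtain ⟨u, hu⟩ := h
  obtain ⟨f', hf', hsub, h0⟩ := hf.exists_eq_zero i.range (Function.extend i u 0) (by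
    rintro _ ⟨x, rfl⟩ _ ⟨y, rfl⟩
    rw [← map_mul, hi.extend_apply, hi.extend_apply, hi.extend_apply]
    exact hu x y)
  have := sub_mem (hf'.index_nsmul_mem_of_eq_zero _ h0) (nsmul_mem hsub i.range.index)
  rwa [nsmul_sub, sub_sub_cancel] at this

end Cocycles

section Commutative

variable {N A : Type*} [CommGroup N] [AddCommGroup A]

/-- The commutator pairing of a 2-cocycle on an abelian group. -/
def commutatorPairing {f : N × N → A} (hf : IsTrivialCocycle₂ f) :
    Additive N →+ Additive N →+ A :=
  have hadd (x y z : N) : f (x * y, z) - f (z, x * y) =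
      (f (x, z) - f (z, x)) + (f (y, z) - f (z, y)) := by
    have h₁ := hf x y z
    have h₂ := hf z x y
    have h₃ := hf x z y
    rw [mul_comm z x] at h₂
    rw [mul_comm z y] at h₃
    rw [eq_sub_of_add_eq h₁, ← sub_eq_of_eq_add' h₂, eq_sub_of_add_eq' h₃.symm]
    abel
  AddMonoidHom.mk' (fun x ↦ AddMonoidHom.mk' (fun y ↦ f (x.toMul, y.toMul) - f (y.toMul, x.toMul))
    fun y z ↦ by
      rw [← neg_sub, toMul_add, hadd]
      abel)
    fun x y ↦ by
      ext z
      exact hadd x.toMul y.toMul (Additive.toMul z)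

theorem commutatorPairing_apply {f : N × N → A} (hf : IsTrivialCocycle₂ f) (x y : Additive N) :
    commutatorPairing hf x y = f (x.toMul, y.toMul) - f (y.toMul, x.toMul) := rfl

theorem IsTrivialCocycle₂.symmetric_of_closure_eq_top {f : N × N → A} (hf : IsTrivialCocycle₂ f)
    {a b : N} (hab : Subgroup.closure {a, b} = ⊤) (hc : f (a, b) = f (b, a)) (x y : N) :
    f (x, y) = f (y, x) := by
  have key (c : N) (ha : f (c, a) = f (a, c)) (hb : f (c, b) = f (b, c)) (y : N) :
      f (c, y) = f (y, c) := by
    suffices h : commutatorPairing hf (.ofMul c) (.ofMul y) = 0 from sub_eq_zero.1 h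
    have hy : y ∈ Subgroup.closure {a, b} := hab ▸ Subgroup.mem_top y
    induction hy using Subgroup.closure_induction with
    | mem z hz =>
      obtain rfl | rfl := hz
      exacts [sub_eq_zero.2 ha, sub_eq_zero.2 hb]
    | one => exact map_zero _
    | mul z w _ _ hz hw => rw [ofMul_mul, map_add, hz, hw, add_zero]
    | inv z _ hz => rw [ofMul_inv, map_neg, hz, neg_zero]
  have ha := key a rfl hc
  have hb := key b hc.symm rfl
  exact key x (ha x).symm (hb x).symm y

end Commutative

/-- The underlying type of the central extension of `N` by `A` defined by a 2-cocycle. -/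
@[ext]
structure CocycleExtension (A N : Type*) where
  /-- The component in the kernel. -/
  fst : A
  /-- The component in the quotient. -/
  snd : N

section Split

variable {N A : Type*} [CommGroup N] [AddCommGroup A]

/-- The group structure on the extension of `N` by `A` defined by a symmetric 2-cocycle. -/
abbrev CocycleExtension.addCommGroup {f : N × N → A} (hf : IsTrivialCocycle₂ f)
    (hs : ∀ x y, f (x, y) = f (y, x)) : AddCommGroup (CocycleExtension A N) :=
  letI : Add (CocycleExtension A N) := ⟨fun p q ↦ ⟨p.1 + q.1 + f (p.2, q.2), p.2 * q.2⟩⟩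
  letI : Zero (CocycleExtension A N) := ⟨⟨-f (1, 1), 1⟩⟩
  letI : Neg (CocycleExtension A N) := ⟨fun p ↦ ⟨-p.1 - f (p.2⁻¹, p.2) - f (1, 1), p.2⁻¹⟩⟩
  { AddGroup.ofLeftAxioms (G := CocycleExtension A N)
      (fun p q r ↦ CocycleExtension.ext (by
        change p.1 + q.1 + f (p.2, q.2) + r.1 + f (p.2 * q.2, r.2) =
          p.1 + (q.1 + r.1 + f (q.2, r.2)) + f (p.2, q.2 * r.2)
        rw [eq_sub_of_add_eq (hf p.2 q.2 r.2)]
        abel) (mul_assoc _ _ _))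
      (fun p ↦ CocycleExtension.ext (by
        change -f (1, 1) + p.1 + f (1, p.2) = p.1
        rw [hf.one_left p.2]
        abel) (one_mul _))
      (fun p ↦ CocycleExtension.ext (by
        change -p.1 - f (p.2⁻¹, p.2) - f (1, 1) + p.1 + f (p.2⁻¹, p.2) = -f (1, 1)
        abel) (inv_mul_cancel _)) with
    add_comm := fun p q ↦ CocycleExtension.ext (by
      change p.1 + q.1 + f (p.2, q.2) = q.1 + p.1 + f (q.2, p.2)
      rw [hs, add_comm p.1]) (mul_comm _ _) }

/-- Symmetric 2-cocycles with values in a divisible group are coboundaries. -/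
theorem IsTrivialCocycle₂.mem_trivialCoboundaries₂_of_symmetric {N A : Type} [CommGroup N]
    [AddCommGroup A] [DivisibleBy A ℤ] {f : N × N → A} (hf : IsTrivialCocycle₂ f)
    (hs : ∀ x y, f (x, y) = f (y, x)) : f ∈ trivialCoboundaries₂ N A := by
  let := CocycleExtension.addCommGroup hf hs
  let i : A →+ CocycleExtension A N := AddMonoidHom.mk' (fun a ↦ ⟨a - f (1, 1), 1⟩) fun a b ↦
    CocycleExtension.ext (by
      change a + b - f (1, 1) = a - f (1, 1) + (b - f (1, 1)) + f (1, 1)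
      abel) (mul_one 1).symm
  have hi : Function.Injective i := fun a b h ↦ by
    simpa [i] using congrArg CocycleExtension.fst h
  obtain ⟨r, hr⟩ := (Module.Baer.of_divisible A).injective.out i.toIntLinearMap hi LinearMap.id
  refine ⟨fun x ↦ r ⟨0, x⟩, fun x y ↦ ?_⟩
  have h : (⟨0, x⟩ + ⟨0, y⟩ : CocycleExtension A N) = i (f (x, y)) + ⟨0, x * y⟩ :=
    CocycleExtension.ext (by
      change 0 + 0 + f (x, y) = f (x, y) - f (1, 1) + 0 + f (1, x * y)
      rw [hf.one_left (x * y)]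
      abel) (one_mul _).symm
  have h' := congrArg r h
  rw [map_add, map_add, show r (i (f (x, y))) = f (x, y) from hr _] at h'
  rw [eq_sub_of_add_eq h'.symm]
  abel

end Split

section SemidirectProduct

open SemidirectProduct

variable {N K A : Type*} [Group N] [Group K] [AddCommGroup A] {φ : K →* MulAut N}

theorem SemidirectProduct.index_range_inl [Finite N] [Finite K] :
    (inl : N →* N ⋊[φ] K).range.index = Nat.card K := by
  rw [range_inl_eq_ker_rightHom, Subgroup.index_ker, MonoidHom.range_eq_top.2 rightHom_surjective,
    Subgroup.card_top]

theorem SemidirectProduct.index_range_inr [Finite N] [Finite K] :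
    (inr : K →* N ⋊[φ] K).range.index = Nat.card N := by
  have h := (inr : K →* N ⋊[φ] K).range.card_mul_index
  rw [SemidirectProduct.card, mul_comm (Nat.card N),
    ← Nat.card_congr (MonoidHom.ofInjective (inr_injective (φ := φ))).toEquiv] at h
  exact Nat.eq_of_mul_eq_mul_left Nat.card_pos h

/-- For coprime factors, triviality of a 2-cocycle on a semidirect product can be checked on
the factors. -/
theorem IsTrivialCocycle₂.mem_of_restrict [Finite N] [Finite K]
    (hcop : (Nat.card N).Coprime (Nat.card K)) {f : (N ⋊[φ] K) × (N ⋊[φ] K) → A}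
    (hf : IsTrivialCocycle₂ f)
    (hN : f ∘ Prod.map (inl : N →* N ⋊[φ] K) inl ∈ trivialCoboundaries₂ N A)
    (hK : f ∘ Prod.map (inr : K →* N ⋊[φ] K) inr ∈ trivialCoboundaries₂ K A) :
    f ∈ trivialCoboundaries₂ (N ⋊[φ] K) A := by
  have : Finite (N ⋊[φ] K) := Finite.of_equiv _ equivProd.symm
  have h₁ := hf.index_nsmul_mem inl inl_injective hN
  have h₂ := hf.index_nsmul_mem inr inr_injective hK
  rw [index_range_inl] at h₁
  rw [index_range_inr] at h₂
  have h := add_mem (zsmul_mem h₂ ((Nat.card N).gcdA (Nat.card K)))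
    (zsmul_mem h₁ ((Nat.card N).gcdB (Nat.card K)))
  rw [← natCast_zsmul, ← natCast_zsmul, ← mul_zsmul', ← mul_zsmul', ← add_zsmul,
    ← Nat.gcd_eq_gcd_ab, hcop, Nat.cast_one, one_zsmul] at h
  exact h

/-- A `K`-invariant bimultiplicative pairing on `N` gives a 2-cocycle on `N ⋊ K`. -/
theorem isTrivialCocycle₂_of_invariant_pairing {β : N → N → A}
    (hl : ∀ x y z, β (x * y) z = β x z + β y z) (hr : ∀ x y z, β x (y * z) = β x y + β x z)
    (hφ : ∀ k x y, β (φ k x) (φ k y) = β x y) :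
    IsTrivialCocycle₂ fun p : (N ⋊[φ] K) × (N ⋊[φ] K) ↦ β p.1.left (φ p.1.right p.2.left) := by
  intro x y z
  simp only [mul_left, mul_right, map_mul, hl, hr, MulAut.mul_apply, hφ]
  abel

end SemidirectProduct

section Units

/-- The roots of unity give a parametrization of the `n`-torsion of `ℂˣ` by `ZMod n`. -/
theorem exists_zmod_hom_additive_units_complex (n : ℕ) [NeZero n] :
    ∃ χ : ZMod n →+ Additive ℂˣ, Function.Injective χ ∧ ∀ z, n • z = 0 → ∃ j, χ j = z := by
  obtain ⟨ζ, hζ⟩ : ∃ ζ : ℂˣ, IsPrimitiveRoot ζ n :=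
    ⟨_, (Complex.isPrimitiveRoot_exp n (NeZero.ne n)).isUnit_unit (NeZero.ne n)⟩
  refine ⟨(MonoidHom.toAdditive (Subgroup.zpowers ζ).subtype).comp
      hζ.zmodEquivZPowers.toAddMonoidHom,
    Subtype.val_injective.comp hζ.zmodEquivZPowers.injective, fun z hz ↦ ?_⟩
  have hmem : z.toMul ∈ Subgroup.zpowers ζ := by
    rw [hζ.zpowers_eq]
    exact hz
  exact ⟨hζ.zmodEquivZPowers.symm (.ofMul ⟨z.toMul, hmem⟩),
    congrArg (fun w ↦ (Additive.ofMul (w.toMul : ℂˣ))) (hζ.zmodEquivZPowers.apply_symm_apply _)⟩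

noncomputable instance : DivisibleBy (Additive ℂˣ) ℤ :=
  letI : DivisibleBy (Additive ℂˣ) ℕ := divisibleByOfSMulRightSurj _ _ fun {n} hn z ↦ by
    obtain ⟨w, hw⟩ := IsAlgClosed.exists_pow_nat_eq (z.toMul : ℂ) (Nat.pos_of_ne_zero hn)
    have hw0 : w ≠ 0 := by
      rintro rfl
      exact z.toMul.ne_zero (by rw [← hw, zero_pow hn])
    exact ⟨.ofMul (Units.mk0 w hw0), Units.ext hw⟩
  AddGroup.divisibleByIntOfDivisibleByNat _

end Units

section ZModSq

/-- The standard alternating form on `(ℤ/n)²`. -/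
def zmodSqDet {n : ℕ} (x y : Multiplicative (ZMod n × ZMod n)) : ZMod n :=
  x.toAdd.1 * y.toAdd.2 - y.toAdd.1 * x.toAdd.2

/-- The first standard generator of `(ℤ/n)²`. -/
abbrev zmodSqFst (n : ℕ) : Multiplicative (ZMod n × ZMod n) := .ofAdd (1, 0)

/-- The second standard generator of `(ℤ/n)²`. -/
abbrev zmodSqSnd (n : ℕ) : Multiplicative (ZMod n × ZMod n) := .ofAdd (0, 1)

theorem eq_zmodSqFst_pow_mul_zmodSqSnd_pow {n : ℕ} [NeZero n]
    (x : Multiplicative (ZMod n × ZMod n)) :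
    x = zmodSqFst n ^ x.toAdd.1.val * zmodSqSnd n ^ x.toAdd.2.val := by
  apply Multiplicative.toAdd.injective
  ext <;> simp

theorem closure_zmodSq (n : ℕ) [NeZero n] :
    Subgroup.closure {zmodSqFst n, zmodSqSnd n} = ⊤ := by
  refine eq_top_iff.2 fun x _ ↦ ?_
  rw [eq_zmodSqFst_pow_mul_zmodSqSnd_pow x]
  exact mul_mem (pow_mem (Subgroup.subset_closure (by simp)) _)
    (pow_mem (Subgroup.subset_closure (by simp)) _)

theorem zmodSqDet_map {n : ℕ} [NeZero n] (ψ : MulAut (Multiplicative (ZMod n × ZMod n)))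
    (x y : Multiplicative (ZMod n × ZMod n)) :
    zmodSqDet (ψ x) (ψ y) = zmodSqDet (ψ (zmodSqFst n)) (ψ (zmodSqSnd n)) * zmodSqDet x y := by
  have hψ (z : Multiplicative (ZMod n × ZMod n)) : (ψ z).toAdd =
      z.toAdd.1 • (ψ (zmodSqFst n)).toAdd + z.toAdd.2 • (ψ (zmodSqSnd n)).toAdd := by
    conv_lhs => rw [eq_zmodSqFst_pow_mul_zmodSqSnd_pow z]
    rw [map_mul, map_pow, map_pow]
    ext <;> simp
  simp only [zmodSqDet, hψ x, hψ y, Prod.fst_add, Prod.snd_add, Prod.smul_fst, Prod.smul_snd,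
    smul_eq_mul]
  ring

theorem zmodSqDet_eq_one_of_pow_three {ψ : MulAut (Multiplicative (ZMod 4 × ZMod 4))}
    (hψ : ψ ^ 3 = 1) : zmodSqDet (ψ (zmodSqFst 4)) (ψ (zmodSqSnd 4)) = 1 := by
  have h : zmodSqDet ((ψ ^ 3) (zmodSqFst 4)) ((ψ ^ 3) (zmodSqSnd 4)) = 1 := by
    rw [hψ]
    simp [zmodSqDet]
  have hassoc (x : Multiplicative (ZMod 4 × ZMod 4)) : (ψ ^ 3) x = ψ (ψ (ψ x)) := rfl
  rw [hassoc, hassoc, zmodSqDet_map ψ (ψ (ψ _)), zmodSqDet_map ψ (ψ _)] at h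
  generalize zmodSqDet (ψ (zmodSqFst 4)) (ψ (zmodSqSnd 4)) = d at h
  revert d
  decide

variable {K : Type*} [Group K] [Fintype K] {n : ℕ}

/-- The average over `K` of the bilinear form `(x, y) ↦ x₁ y₂` on `(ℤ/n)²`. -/
def averagedPairing (φ : K →* MulAut (Multiplicative (ZMod n × ZMod n)))
    (x y : Multiplicative (ZMod n × ZMod n)) : ZMod n :=
  ∑ k, (φ k x).toAdd.1 * (φ k y).toAdd.2

variable (φ : K →* MulAut (Multiplicative (ZMod n × ZMod n)))

theorem averagedPairing_mul_left (x y z : Multiplicative (ZMod n × ZMod n)) :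
    averagedPairing φ (x * y) z = averagedPairing φ x z + averagedPairing φ y z := by
  simp [averagedPairing, add_mul, Finset.sum_add_distrib]

theorem averagedPairing_mul_right (x y z : Multiplicative (ZMod n × ZMod n)) :
    averagedPairing φ x (y * z) = averagedPairing φ x y + averagedPairing φ x z := by
  simp [averagedPairing, mul_add, Finset.sum_add_distrib]

theorem averagedPairing_map (k : K) (x y : Multiplicative (ZMod n × ZMod n)) :
    averagedPairing φ (φ k x) (φ k y) = averagedPairing φ x y := by
  simp only [averagedPairing, ← MulAut.mul_apply, ← map_mul]
  exact Equiv.sum_comp (Equiv.mulRight k) fun k ↦ (φ k x).toAdd.1 * (φ k y).toAdd.2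

theorem averagedPairing_sub_swap (x y : Multiplicative (ZMod n × ZMod n)) :
    averagedPairing φ x y - averagedPairing φ y x = ∑ k, zmodSqDet (φ k x) (φ k y) := by
  simp only [averagedPairing, zmodSqDet, Finset.sum_sub_distrib]

end ZModSq

theorem averagedPairing_fst_snd_sub_swap
    (φ : Multiplicative (ZMod 3) →* MulAut (Multiplicative (ZMod 4 × ZMod 4))) :
    averagedPairing φ (zmodSqFst 4) (zmodSqSnd 4) -
      averagedPairing φ (zmodSqSnd 4) (zmodSqFst 4) = -1 := by
  have h (k : Multiplicative (ZMod 3)) :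
      zmodSqDet (φ k (zmodSqFst 4)) (φ k (zmodSqSnd 4)) = 1 := by
    refine zmodSqDet_eq_one_of_pow_three ?_
    rw [← map_pow, show k ^ 3 = 1 by revert k; decide, map_one]
  rw [averagedPairing_sub_swap, Finset.sum_congr rfl fun k _ ↦ h k]
  decide

theorem closure_ofAdd_one_zmod (n : ℕ) [NeZero n] :
    Subgroup.closure {Multiplicative.ofAdd (1 : ZMod n), .ofAdd 1} = ⊤ := by
  refine eq_top_iff.2 fun x _ ↦ ?_
  have hx : x = Multiplicative.ofAdd (1 : ZMod n) ^ x.toAdd.val := by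
    apply Multiplicative.toAdd.injective
    simp
  rw [hx]
  exact pow_mem (Subgroup.subset_closure (by simp)) _

open SemidirectProduct

/-- A 2-cocycle on `(ℤ/4)² ⋊ ℤ/3` with values in a divisible group is a coboundary as soon as its
commutator pairing vanishes on the standard generators of `(ℤ/4)²`. -/
theorem IsTrivialCocycle₂.mem_of_commutator_eq {A : Type} [AddCommGroup A] [DivisibleBy A ℤ]
    {φ : Multiplicative (ZMod 3) →* MulAut (Multiplicative (ZMod 4 × ZMod 4))}
    {f : (Multiplicative (ZMod 4 × ZMod 4) ⋊[φ] Multiplicative (ZMod 3)) ×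
      (Multiplicative (ZMod 4 × ZMod 4) ⋊[φ] Multiplicative (ZMod 3)) → A}
    (hf : IsTrivialCocycle₂ f)
    (hc : f (inl (zmodSqFst 4), inl (zmodSqSnd 4)) = f (inl (zmodSqSnd 4), inl (zmodSqFst 4))) :
    f ∈ trivialCoboundaries₂ _ A := by
  refine hf.mem_of_restrict (by simp; decide) ?_ ?_
  · exact (hf.comp inl).mem_trivialCoboundaries₂_of_symmetric
      ((hf.comp inl).symmetric_of_closure_eq_top (closure_zmodSq 4) hc)
  · exact (hf.comp inr).mem_trivialCoboundaries₂_of_symmetric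
      ((hf.comp inr).symmetric_of_closure_eq_top (closure_ofAdd_one_zmod 3) rfl)

/-- The cocycles on `(ℤ/4)² ⋊ K` obtained from multiples of the averaged pairing. -/
def averagedCocycle {A : Type} [AddCommGroup A] {K : Type} [Group K] [Fintype K] {n : ℕ}
    (χ : ZMod n →+ A) (φ : K →* MulAut (Multiplicative (ZMod n × ZMod n))) :
    ZMod n →+ cocycles₂ (Rep.trivial ℤ (Multiplicative (ZMod n × ZMod n) ⋊[φ] K) A) :=
  AddMonoidHom.mk' (fun j ↦
    ⟨fun p ↦ χ (j * averagedPairing φ p.1.left (φ p.1.right p.2.left)),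
      mem_cocycles₂_trivial_iff.2 <| isTrivialCocycle₂_of_invariant_pairing
        (β := fun x y ↦ χ (j * averagedPairing φ x y))
        (fun x y z ↦ by rw [averagedPairing_mul_left, mul_add, map_add])
        (fun x y z ↦ by rw [averagedPairing_mul_right, mul_add, map_add])
        (fun k x y ↦ by rw [averagedPairing_map])⟩)
    fun i j ↦ Subtype.ext <| funext fun p ↦ by
      change χ _ = χ _ + χ _
      rw [add_mul, map_add]

theorem averagedCocycle_inl {A : Type} [AddCommGroup A] {K : Type} [Group K] [Fintype K] {n : ℕ}
    (χ : ZMod n →+ A) (φ : K →* MulAut (Multiplicative (ZMod n × ZMod n))) (j : ZMod n)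
    (x y : Multiplicative (ZMod n × ZMod n)) :
    (averagedCocycle χ φ j).1 (inl x, inl y) = χ (j * averagedPairing φ x y) := by
  change χ (j * averagedPairing φ x (φ 1 y)) = _
  rw [map_one, MulAut.one_apply]

theorem averagedCocycle_commutator {A : Type} [AddCommGroup A] (χ : ZMod 4 →+ A)
    (φ : Multiplicative (ZMod 3) →* MulAut (Multiplicative (ZMod 4 × ZMod 4))) (j : ZMod 4) :
    ((averagedCocycle χ φ j).1 (inl (zmodSqFst 4), inl (zmodSqSnd 4)) : A) -
      (averagedCocycle χ φ j).1 (inl (zmodSqSnd 4), inl (zmodSqFst 4)) = χ (-j) := by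
  rw [averagedCocycle_inl, averagedCocycle_inl, ← map_sub, ← mul_sub,
    averagedPairing_fst_snd_sub_swap, mul_neg_one]

/-- Let `φ : ℤ/3 → Aut(ℤ/4 × ℤ/4)` be an injective homomorphism and let
`G = (ℤ/4 × ℤ/4) ⋊ ℤ/3` be the corresponding semidirect product, a group of
order 48.  Then the Schur multiplier of `G`, i.e. the second cohomology group
`H²(G, ℂˣ)` with trivial action, is cyclic of order 4. -/
theorem schur_multiplier_of_f44_semidirect_z3
    (φ : Multiplicative (ZMod 3) →* MulAut (Multiplicative (ZMod 4 × ZMod 4)))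
    (hφ : Function.Injective φ) :
    Nonempty
      ((groupCohomology
          (Rep.trivial ℤ
            (Multiplicative (ZMod 4 × ZMod 4) ⋊[φ] Multiplicative (ZMod 3))
            (Additive ℂˣ)) 2) ≃+ ZMod 4) := by
  obtain ⟨χ, hχ, hχ_surj⟩ := exists_zmod_hom_additive_units_complex 4
  let Φ := (H2π (Rep.trivial ℤ (Multiplicative (ZMod 4 × ZMod 4) ⋊[φ] Multiplicative (ZMod 3))
    (Additive ℂˣ))).hom.toAddMonoidHom.comp (averagedCocycle χ φ)
  refine ⟨(AddEquiv.ofBijective Φ ⟨(injective_iff_map_eq_zero Φ).2 fun j hj ↦ ?_, fun c ↦ ?_⟩).symm⟩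
  · obtain ⟨u, hu⟩ := mem_coboundaries₂_trivial_iff.1 ((H2π_eq_zero_iff _).1 hj)
    have h := averagedCocycle_commutator χ φ j
    rw [show (averagedCocycle χ φ j).1 _ = _ from hu _ _,
      show (averagedCocycle χ φ j).1 _ = _ from hu _ _, ← map_mul inl (zmodSqFst 4),
      ← map_mul inl (zmodSqSnd 4), mul_comm (zmodSqSnd 4)] at h
    refine neg_eq_zero.1 (hχ ?_)
    rw [← h, map_zero]
    abel
  · induction c using H2_induction_on with | h f
    have hf := mem_cocycles₂_trivial_iff.1 f.2
    have htor : 4 • (f.1 (inl (zmodSqFst 4), inl (zmodSqSnd 4)) -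
        f.1 (inl (zmodSqSnd 4), inl (zmodSqFst 4))) = 0 := by
      change 4 • commutatorPairing (hf.comp inl) (.ofMul (zmodSqFst 4)) (.ofMul (zmodSqSnd 4)) = 0
      rw [← map_nsmul, show 4 • Additive.ofMul (zmodSqSnd 4) = 0 by decide, map_zero]
    obtain ⟨j, hj⟩ := hχ_surj _ htor
    refine ⟨-j, (H2π_eq_iff _ _).2 (mem_coboundaries₂_trivial_iff.2 ?_)⟩
    refine (mem_cocycles₂_trivial_iff.1
      (averagedCocycle χ φ (-j) - f).2).mem_of_commutator_eq (sub_eq_zero.1 ?_)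
    have h := averagedCocycle_commutator χ φ (-j)
    rw [neg_neg, hj, ← sub_eq_zero, sub_sub_sub_comm] at h
    exact h
end
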